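/- arXiv:2510.03803 — 11 statements merged into one kernel-verified Lean document; each statement's English description precedes it below -/
import Mathlib

section
/- (Existence of a nonnegative cost matrix: surjectivity of the forward map onto the target set.) Let μ, ν ∈ ℝ^n be probability vectors and let X̂ ∈ U(μ,ν) be such that every entry X̂_{ij} lies in I, and in addition: if φ'_0 = −∞ then X̂_{ij} > 0 for all i,j, and if φ'_1 = +∞ then X̂_{ij} < 1 for all i,j. Then there exists a matrix C ∈ ℝ^{n×n} with C_{ij} ≥ 0 for all i,j such that X̂ is the unique minimizer of J_C over U_I(μ,ν). -/
open Filter Set Topology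

namespace IOT

/-- `μ` is a probability vector. -/
def ProbVec {n : ℕ} (μ : Fin n → ℝ) : Prop :=
  (∀ i, 0 ≤ μ i) ∧ (∑ i, μ i) = 1

/-- `X` belongs to the transport polytope `U(μ,ν)`. -/
def MemU {n : ℕ} (μ ν : Fin n → ℝ) (X : Fin n → Fin n → ℝ) : Prop :=
  (∀ i j, 0 ≤ X i j) ∧ (∀ i, (∑ j, X i j) = μ i) ∧ (∀ j, (∑ i, X i j) = ν j)

/-- `X ∈ U(μ,ν)` with all entries in `I`. -/
def MemUI {n : ℕ} (μ ν : Fin n → ℝ) (I : Set ℝ) (X : Fin n → Fin n → ℝ) : Prop :=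
  MemU μ ν X ∧ ∀ i j, X i j ∈ I

/-- The regularized transport objective `J_C(X) = ⟨C,X⟩ + γ Σ φ(X_ij)`. -/
noncomputable def JCost {n : ℕ} (γ : ℝ) (φ : ℝ → ℝ) (C X : Fin n → Fin n → ℝ) : ℝ :=
  (∑ i, ∑ j, C i j * X i j) + γ * ∑ i, ∑ j, φ (X i j)

/-- `Xh` is the unique minimizer of `J_C` over `U_I(μ,ν)`. -/
def UniqueMin {n : ℕ} (μ ν : Fin n → ℝ) (I : Set ℝ) (γ : ℝ) (φ : ℝ → ℝ)
    (C Xh : Fin n → Fin n → ℝ) : Prop :=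
  MemUI μ ν I Xh ∧ ∀ X, MemUI μ ν I X → X ≠ Xh → JCost γ φ C Xh < JCost γ φ C X

/-- Membership in `S_h`: nonnegative, symmetric, zero diagonal. -/
def MemSh {n : ℕ} (C : Fin n → Fin n → ℝ) : Prop :=
  (∀ i j, 0 ≤ C i j) ∧ (∀ i j, C i j = C j i) ∧ (∀ i, C i i = 0)

/-- The recovery matrix `G(X)_{ij} = (γ/2)(φ'(X_ii)+φ'(X_jj)-φ'(X_ij)-φ'(X_ji))`. -/
noncomputable def Gmat {n : ℕ} (γ : ℝ) (φ' : ℝ → ℝ) (X : Fin n → Fin n → ℝ) : Fin n → Fin n → ℝ :=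
  fun i j => γ / 2 * (φ' (X i i) + φ' (X j j) - φ' (X i j) - φ' (X j i))

/-- The Bregman divergence `B_φ(x ‖ y)`. -/
noncomputable def Breg (φ φ' : ℝ → ℝ) (x y : ℝ) : ℝ := φ x - φ y - (x - y) * φ' y

end IOT

namespace IOT

/-- A function whose derivative on `(0, 1)` lies below `s` to the left of `y` and above `s`
to the right of `y` lies strictly above the line of slope `s` through `(y, φ y)`. -/
theorem add_mul_sub_lt_of_deriv_separated {I : Set ℝ} (hIoc : I.OrdConnected)
    (hI01 : Set.Ioo (0:ℝ) 1 ⊆ interior I) {φ φ' : ℝ → ℝ} (hφcont : ContinuousOn φ I)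
    (hφderiv : ∀ x ∈ interior I, HasDerivAt φ (φ' x) x) {s x y : ℝ}
    (hleft : ∀ t ∈ Set.Ioo (0:ℝ) 1, t < y → φ' t < s)
    (hright : ∀ t ∈ Set.Ioo (0:ℝ) 1, y < t → s < φ' t)
    (hy : y ∈ Set.Icc (0:ℝ) 1) (hyI : y ∈ I) (hx : x ∈ Set.Icc (0:ℝ) 1) (hxI : x ∈ I)
    (hxy : x ≠ y) : φ y + s * (x - y) < φ x := by
  rcases lt_or_gt_of_ne hxy with h | h
  · obtain ⟨t, ht, hs⟩ := exists_hasDerivAt_eq_slope φ φ' h (hφcont.mono (hIoc.out hxI hyI))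
      (fun t ht => hφderiv t (hI01 ⟨hx.1.trans_lt ht.1, ht.2.trans_le hy.2⟩))
    have := hleft t ⟨hx.1.trans_lt ht.1, ht.2.trans_le hy.2⟩ ht.2
    rw [hs, div_lt_iff₀ (by linarith)] at this
    linarith
  · obtain ⟨t, ht, hs⟩ := exists_hasDerivAt_eq_slope φ φ' h (hφcont.mono (hIoc.out hyI hxI))
      (fun t ht => hφderiv t (hI01 ⟨hy.1.trans_lt ht.1, ht.2.trans_le hx.2⟩))
    have := hright t ⟨hy.1.trans_lt ht.1, ht.2.trans_le hx.2⟩ ht.1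
    rw [hs, lt_div_iff₀ (by linarith)] at this
    linarith

/-- A strictly increasing function on `(0, 1)` has a value separating its values to the left of `y`
from those to the right, unless `y` is an endpoint at which the function is unbounded. -/
theorem exists_separating_value {g : ℝ → ℝ} (hg : StrictMonoOn g (Set.Ioo 0 1)) {y : ℝ}
    (hy : y ∈ Set.Icc (0:ℝ) 1) (hpos : Tendsto g (𝓝[>] (0:ℝ)) atBot → 0 < y)
    (hlt1 : Tendsto g (𝓝[<] (1:ℝ)) atTop → y < 1) :
    ∃ s, (∀ t ∈ Set.Ioo (0:ℝ) 1, t < y → g t < s) ∧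
      ∀ t ∈ Set.Ioo (0:ℝ) 1, y < t → s < g t := by
  rcases hy.1.eq_or_lt with rfl | h0
  · by_contra! hcon
    refine lt_irrefl _ (hpos (tendsto_atBot.2 fun b => ?_))
    obtain ⟨t, ht, -, htb⟩ := hcon b fun t ht h => absurd h ht.1.not_gt
    filter_upwards [Ioo_mem_nhdsGT ht.1] with u hu
    exact (hg ⟨hu.1, hu.2.trans ht.2⟩ ht hu.2).le.trans htb
  rcases hy.2.eq_or_lt with rfl | h1
  · by_contra! hcon
    refine lt_irrefl _ (hlt1 (tendsto_atTop.2 fun b => ?_))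
    by_cases hb : ∀ t ∈ Set.Ioo (0:ℝ) 1, t < 1 → g t < b
    · obtain ⟨t, ht, h, -⟩ := hcon b hb
      exact absurd h ht.2.not_gt
    push Not at hb
    obtain ⟨t, ht, -, htb⟩ := hb
    filter_upwards [Ioo_mem_nhdsLT ht.2] with u hu
    exact htb.trans (hg ht ⟨ht.1.trans hu.1, hu.2⟩ hu.1).le
  · exact ⟨g y, fun t ht h => hg ht ⟨h0, h1⟩ h, fun t ht h => hg ⟨h0, h1⟩ ht h⟩

/-- The entries of a transport plan between probability vectors lie in `[0, 1]`. -/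
theorem MemU.mem_Icc {n : ℕ} {μ ν : Fin n → ℝ} {X : Fin n → Fin n → ℝ} (hμ : ProbVec μ)
    (hX : MemU μ ν X) (i j : Fin n) : X i j ∈ Set.Icc (0:ℝ) 1 := by
  refine ⟨hX.1 i j, ?_⟩
  calc X i j ≤ ∑ j, X i j :=
        Finset.single_le_sum (fun j _ => hX.1 i j) (Finset.mem_univ j)
    _ = μ i := hX.2.1 i
    _ ≤ ∑ i, μ i := Finset.single_le_sum (fun i _ => hμ.1 i) (Finset.mem_univ i)
    _ = 1 := hμ.2

/-- The total mass of a transport plan between probability vectors is `1`. -/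
theorem MemU.sum_eq_one {n : ℕ} {μ ν : Fin n → ℝ} {X : Fin n → Fin n → ℝ} (hμ : ProbVec μ)
    (hX : MemU μ ν X) : ∑ i, ∑ j, X i j = 1 := by
  simp_rw [hX.2.1, hμ.2]


/-- existence of a nonnegative cost matrix whose unique regularized
transport plan is a prescribed `Xh` in the target set. -/
theorem stmt1 {n : ℕ} (hn : 0 < n)
    (I : Set ℝ) (hIoc : I.OrdConnected) (hI01 : Set.Ioo (0:ℝ) 1 ⊆ interior I)
    (φ φ' : ℝ → ℝ)
    (hφcont : ContinuousOn φ I)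
    (hφconv : ConvexOn ℝ I φ)
    (hφderiv : ∀ x ∈ interior I, HasDerivAt φ (φ' x) x)
    (hφ'cont : ContinuousOn φ' (interior I))
    (hφstrict : StrictConvexOn ℝ (interior I) φ)
    (hφ'0fin : ∀ c : ℝ, Tendsto φ' (𝓝[>] (0:ℝ)) (𝓝 c) → 0 ∈ I → φ' 0 = c)
    (hφ'1fin : ∀ c : ℝ, Tendsto φ' (𝓝[<] (1:ℝ)) (𝓝 c) → 1 ∈ I → φ' 1 = c)
    (γ : ℝ) (hγ : 0 < γ)
    (μ ν : Fin n → ℝ) (hμ : ProbVec μ) (hν : ProbVec ν)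
    (Xh : Fin n → Fin n → ℝ) (hXhU : MemU μ ν Xh) (hXhI : ∀ i j, Xh i j ∈ I)
    (hpos : Tendsto φ' (𝓝[>] (0:ℝ)) atBot → ∀ i j, 0 < Xh i j)
    (hlt1 : Tendsto φ' (𝓝[<] (1:ℝ)) atTop → ∀ i j, Xh i j < 1) :
    ∃ C : Fin n → Fin n → ℝ, (∀ i j, 0 ≤ C i j) ∧ UniqueMin μ ν I γ φ C Xh := by
  have hmono : StrictMonoOn φ' (Set.Ioo 0 1) := by
    intro x hx y hy hxy
    have hs := hφstrict.subset hI01 (convex_Ioo 0 1)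
    exact (hs.lt_slope_of_hasDerivAt hx hy hxy (hφderiv x (hI01 hx))).trans
      (hs.slope_lt_of_hasDerivAt hx hy hxy (hφderiv y (hI01 hy)))
  have hsep := fun i j => exists_separating_value hmono (hXhU.mem_Icc hμ i j)
    (fun h => hpos h i j) (fun h => hlt1 h i j)
  choose s hleft hright using hsep
  have hline : ∀ X, MemUI μ ν I X → ∀ i j, X i j ≠ Xh i j →
      φ (Xh i j) + s i j * (X i j - Xh i j) < φ (X i j) := fun X hX i j hne =>
    add_mul_sub_lt_of_deriv_separated hIoc hI01 hφcont hφderiv (hleft i j) (hright i j)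
      (hXhU.mem_Icc hμ i j) (hXhI i j) (hX.1.mem_Icc hμ i j) (hX.2 i j) hne
  obtain ⟨M, hM⟩ : ∃ M, ∀ i j, γ * s i j ≤ M :=
    ⟨∑ i, ∑ j, |γ * s i j|, fun i j => (le_abs_self _).trans <|
      (Finset.single_le_sum (f := fun j => |γ * s i j|) (fun _ _ => abs_nonneg _)
        (Finset.mem_univ j)).trans <|
      Finset.single_le_sum (f := fun i => ∑ j, |γ * s i j|)
        (fun _ _ => Finset.sum_nonneg fun _ _ => abs_nonneg _) (Finset.mem_univ i)⟩
  refine ⟨fun i j => M - γ * s i j, fun i j => sub_nonneg.2 (hM i j), ⟨hXhU, hXhI⟩, ?_⟩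
  intro X hX hne
  have hJ : ∀ Y, MemU μ ν Y → JCost γ φ (fun i j => M - γ * s i j) Y =
      M + γ * ∑ i, ∑ j, (φ (Y i j) - s i j * Y i j) := by
    intro Y hY
    have hmass := hY.sum_eq_one hμ
    simp only [JCost, sub_mul, Finset.sum_sub_distrib, mul_assoc, ← Finset.mul_sum, hmass]
    ring
  rw [hJ _ hXhU, hJ _ hX.1]
  have hle : ∀ i j, φ (Xh i j) - s i j * Xh i j ≤ φ (X i j) - s i j * X i j := by
    intro i j
    by_cases h : X i j = Xh i j
    · rw [h]
    · linarith [hline X hX i j h]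
  obtain ⟨i, hi⟩ := Function.ne_iff.1 hne
  obtain ⟨j, hij⟩ := Function.ne_iff.1 hi
  have hlt : ∑ i, ∑ j, (φ (Xh i j) - s i j * Xh i j) < ∑ i, ∑ j, (φ (X i j) - s i j * X i j) :=
    Finset.sum_lt_sum (fun i _ => Finset.sum_le_sum fun j _ => hle i j)
      ⟨i, Finset.mem_univ i, Finset.sum_lt_sum (fun j _ => hle i j)
        ⟨j, Finset.mem_univ j, by linarith [hline X hX i j hij]⟩⟩
  gcongr

end IOT
end

section
/- (Injectivity of the forward map up to rank-one additive shifts.) Assume φ'_0 = −∞. Let C¹, C² ∈ ℝ^{n×n}, and suppose there is a matrix X̂ ∈ U(μ,ν) with every entry X̂_{ij} ∈ int(I) and X̂_{ij} > 0, such that X̂ is the unique minimizer of J_{C¹} over U_I(μ,ν) and also the unique minimizer of J_{C²} over U_I(μ,ν). Then there exist vectors a, b ∈ ℝ^n such that C²_{ij} = C¹_{ij} + a_i + b_j for all i,j. -/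
open Filter Set Topology

namespace IOT
/-- First-order optimality: at an interior minimizer, the gradient of `J_C` is orthogonal to every
matrix with zero row and column sums. -/
theorem UniqueMin.sum_gradient_mul_eq_zero {n : ℕ} {μ ν : Fin n → ℝ} {I : Set ℝ} {γ : ℝ}
    {φ φ' : ℝ → ℝ} {C X : Fin n → Fin n → ℝ} (h : UniqueMin μ ν I γ φ C X)
    (hφderiv : ∀ x ∈ interior I, HasDerivAt φ (φ' x) x)
    (hXI : ∀ i j, X i j ∈ interior I) (hXpos : ∀ i j, 0 < X i j)
    {D : Fin n → Fin n → ℝ} (hrow : ∀ i, ∑ j, D i j = 0) (hcol : ∀ j, ∑ i, D i j = 0) :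
    (∑ i, ∑ j, C i j * D i j) + γ * ∑ i, ∑ j, φ' (X i j) * D i j = 0 := by
  have hline (i j : Fin n) : HasDerivAt (fun t : ℝ => X i j + t * D i j) (D i j) 0 := by
    simpa using ((hasDerivAt_id (0 : ℝ)).mul_const (D i j)).const_add (X i j)
  have hderiv : HasDerivAt (fun t : ℝ => JCost γ φ C (fun i j => X i j + t * D i j))
      ((∑ i, ∑ j, C i j * D i j) + γ * ∑ i, ∑ j, φ' (X i j) * D i j) 0 := by
    unfold JCost
    refine HasDerivAt.add ?_ (HasDerivAt.const_mul γ ?_)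
    · exact HasDerivAt.fun_sum fun i _ => HasDerivAt.fun_sum fun j _ =>
        (hline i j).const_mul (C i j)
    · refine HasDerivAt.fun_sum fun i _ => HasDerivAt.fun_sum fun j _ => ?_
      have hφ : HasDerivAt φ (φ' (X i j)) (X i j + 0 * D i j) := by
        simpa using hφderiv _ (hXI i j)
      exact hφ.comp 0 (hline i j)
  have hfeas : ∀ᶠ t in 𝓝 (0 : ℝ), ∀ i j, X i j + t * D i j ∈ interior I ∩ Ioi 0 := by
    refine eventually_all.2 fun i => eventually_all.2 fun j => ?_
    refine (hline i j).continuousAt.eventually_mem ?_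
    exact (isOpen_interior.inter isOpen_Ioi).mem_nhds (by simpa using ⟨hXI i j, hXpos i j⟩)
  have hmin : IsLocalMin (fun t : ℝ => JCost γ φ C (fun i j => X i j + t * D i j)) 0 := by
    filter_upwards [hfeas] with t ht
    simp only [zero_mul, add_zero]
    by_cases hX : (fun i j => X i j + t * D i j) = X
    · rw [hX]
    · refine (h.2 _ ⟨⟨fun i j => (ht i j).2.le, fun i => ?_, fun j => ?_⟩,
        fun i j => interior_subset (ht i j).1⟩ hX).le
      · rw [Finset.sum_add_distrib, ← Finset.mul_sum, hrow, mul_zero, add_zero, h.1.1.2.1]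
      · rw [Finset.sum_add_distrib, ← Finset.mul_sum, hcol, mul_zero, add_zero, h.1.1.2.2]
  exact hmin.hasDerivAt_eq_zero hderiv

/-- injectivity of the forward map up to rank-one additive shifts,
assuming `φ'_0 = -∞`. -/
theorem stmt2 {n : ℕ} (hn : 0 < n)
    (I : Set ℝ) (hIoc : I.OrdConnected) (hI01 : Set.Ioo (0:ℝ) 1 ⊆ interior I)
    (φ φ' : ℝ → ℝ)
    (hφcont : ContinuousOn φ I)
    (hφconv : ConvexOn ℝ I φ)
    (hφderiv : ∀ x ∈ interior I, HasDerivAt φ (φ' x) x)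
    (hφ'cont : ContinuousOn φ' (interior I))
    (hφstrict : StrictConvexOn ℝ (interior I) φ)
    (hφ'0 : Tendsto φ' (𝓝[>] (0:ℝ)) atBot)
    (γ : ℝ) (hγ : 0 < γ)
    (μ ν : Fin n → ℝ) (hμ : ProbVec μ) (hν : ProbVec ν)
    (C1 C2 : Fin n → Fin n → ℝ)
    (Xh : Fin n → Fin n → ℝ) (hXhU : MemU μ ν Xh)
    (hXhI : ∀ i j, Xh i j ∈ interior I) (hXhpos : ∀ i j, 0 < Xh i j)
    (h1 : UniqueMin μ ν I γ φ C1 Xh) (h2 : UniqueMin μ ν I γ φ C2 Xh) :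
    ∃ a b : Fin n → ℝ, ∀ i j, C2 i j = C1 i j + a i + b j := by
  let z : Fin n := ⟨0, hn⟩
  refine ⟨fun i => (C2 i z - C1 i z) - (C2 z z - C1 z z), fun j => C2 z j - C1 z j, fun i j => ?_⟩
  let u (i k : Fin n) : ℝ := (if k = i then 1 else 0) - (if k = z then 1 else 0)
  have hu (i : Fin n) : ∑ k, u i k = 0 := by simp [u]
  have hrow (k : Fin n) : ∑ l, u i k * u j l = 0 := by rw [← Finset.mul_sum, hu, mul_zero]
  have hcol (l : Fin n) : ∑ k, u i k * u j l = 0 := by rw [← Finset.sum_mul, hu, zero_mul]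
  have hsum (C : Fin n → Fin n → ℝ) :
      ∑ k, ∑ l, C k l * (u i k * u j l) = C i j - C i z - C z j + C z z := by
    simp only [u, mul_sub, Finset.sum_sub_distrib, mul_ite, mul_one, mul_zero,
      Finset.sum_ite_eq', Finset.mem_univ, if_true]
    ring
  have e1 := h1.sum_gradient_mul_eq_zero hφderiv hXhI hXhpos hrow hcol
  have e2 := h2.sum_gradient_mul_eq_zero hφderiv hXhI hXhpos hrow hcol
  rw [hsum C1] at e1
  rw [hsum C2] at e2
  linarith

end IOT
end

section
/- (Recovery formula for symmetric zero-diagonal costs: forward direction.) Assume φ'_0 = −∞. Let C ∈ S_h and suppose X̂ ∈ U(μ,ν) with every entry X̂_{ij} ∈ int(I) is the unique minimizer of J_C over U_I(μ,ν). Then for all i,j one has φ'(X̂_{ii}) + φ'(X̂_{jj}) ≥ φ'(X̂_{ij}) + φ'(X̂_{ji}), and moreover C_{ij} = G(X̂)_{ij} = (γ/2)(φ'(X̂_{ii}) + φ'(X̂_{jj}) − φ'(X̂_{ij}) − φ'(X̂_{ji})) for all i,j. -/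
open Filter Set Topology

namespace IOT
/-- An interior feasible point with positive entries minimizing `J_C` satisfies the first-order
condition along the direction `a ⊗ a`, for every `a` with zero sum. -/
theorem UniqueMin.sum_grad_mul_eq_zero {n : ℕ} {I : Set ℝ} {φ φ' : ℝ → ℝ}
    (hφderiv : ∀ x ∈ interior I, HasDerivAt φ (φ' x) x) {γ : ℝ} {μ ν : Fin n → ℝ}
    {C X : Fin n → Fin n → ℝ} (hXI : ∀ i j, X i j ∈ interior I) (hXpos : ∀ i j, 0 < X i j)
    (hmin : UniqueMin μ ν I γ φ C X) {a : Fin n → ℝ} (ha : ∑ k, a k = 0) :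
    ∑ k, ∑ l, (C k l + γ * φ' (X k l)) * (a k * a l) = 0 := by
  set Y : ℝ → Fin n → Fin n → ℝ := fun t k l => X k l + t * (a k * a l) with hY
  have hY0 : Y 0 = X := by simp [hY]
  have hYderiv (k l) : HasDerivAt (fun t => Y t k l) (a k * a l) 0 := by
    simpa [hY] using (hasDerivAt_id (0 : ℝ)).mul_const (a k * a l)
  have hφY (k l) : HasDerivAt (fun t => φ (Y t k l)) (φ' (X k l) * (a k * a l)) 0 :=
    HasDerivAt.comp (h₂ := φ) (0 : ℝ) (by simpa [hY0] using hφderiv _ (hXI k l)) (hYderiv k l)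
  have hJ : HasDerivAt (fun t => JCost γ φ C (Y t))
      ((∑ k, ∑ l, C k l * (a k * a l)) + γ * ∑ k, ∑ l, φ' (X k l) * (a k * a l)) 0 :=
    (HasDerivAt.fun_sum fun k _ => HasDerivAt.fun_sum fun l _ =>
      (hYderiv k l).const_mul (C k l)).add
    ((HasDerivAt.fun_sum fun k _ => HasDerivAt.fun_sum fun l _ => hφY k l).const_mul γ)
  have hmem : ∀ᶠ t in 𝓝 (0 : ℝ), ∀ k l, Y t k l ∈ interior I ∩ Ioi 0 := by
    simp only [eventually_all]
    intro k l
    refine (hYderiv k l).continuousAt.eventually_mem ((isOpen_interior.inter isOpen_Ioi).mem_nhds ?_)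
    rw [hY0]
    exact ⟨hXI k l, hXpos k l⟩
  have hloc : IsLocalMin (fun t => JCost γ φ C (Y t)) 0 := by
    filter_upwards [hmem] with t ht
    rw [hY0]
    by_cases h : Y t = X
    · rw [h]
    · refine (hmin.2 _ ⟨⟨fun k l => (ht k l).2.le, fun k => ?_, fun l => ?_⟩,
        fun k l => interior_subset (ht k l).1⟩ h).le
      · simp only [hY, Finset.sum_add_distrib, ← Finset.mul_sum, ha, mul_zero, add_zero]
        exact hmin.1.1.2.1 k
      · simp only [hY, Finset.sum_add_distrib, ← Finset.mul_sum, ← Finset.sum_mul, ha, zero_mul,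
          mul_zero, add_zero]
        exact hmin.1.1.2.2 l
  rw [← hloc.hasDerivAt_eq_zero hJ]
  simp only [add_mul, Finset.sum_add_distrib, Finset.mul_sum, mul_assoc]

/-- recovery formula for symmetric zero-diagonal costs, forward direction. -/
theorem stmt4 {n : ℕ} (hn : 0 < n)
    (I : Set ℝ) (hIoc : I.OrdConnected) (hI01 : Set.Ioo (0:ℝ) 1 ⊆ interior I)
    (φ φ' : ℝ → ℝ)
    (hφcont : ContinuousOn φ I)
    (hφconv : ConvexOn ℝ I φ)
    (hφderiv : ∀ x ∈ interior I, HasDerivAt φ (φ' x) x)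
    (hφ'cont : ContinuousOn φ' (interior I))
    (hφstrict : StrictConvexOn ℝ (interior I) φ)
    (hφ'0 : Tendsto φ' (𝓝[>] (0:ℝ)) atBot)
    (γ : ℝ) (hγ : 0 < γ)
    (μ ν : Fin n → ℝ) (hμ : ProbVec μ) (hν : ProbVec ν)
    (C : Fin n → Fin n → ℝ) (hC : MemSh C)
    (Xh : Fin n → Fin n → ℝ) (hXhU : MemU μ ν Xh)
    (hXhI : ∀ i j, Xh i j ∈ interior I)
    (hmin : UniqueMin μ ν I γ φ C Xh) :
    (∀ i j, φ' (Xh i j) + φ' (Xh j i) ≤ φ' (Xh i i) + φ' (Xh j j)) ∧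
    (∀ i j, C i j = Gmat γ φ' Xh i j) := by
  have h0 : (0 : ℝ) ∉ interior I := fun h =>
    not_tendsto_atBot_of_tendsto_nhds
      ((hφ'cont.continuousAt (isOpen_interior.mem_nhds h)).mono_left nhdsWithin_le_nhds) hφ'0
  have hpos (i j) : 0 < Xh i j :=
    lt_of_le_of_ne (hXhU.1 i j) fun h => h0 (h ▸ hXhI i j)
  have hG (i j) : C i j = Gmat γ φ' Xh i j := by
    have key := hmin.sum_grad_mul_eq_zero hφderiv hXhI hpos
      (a := Pi.single i 1 - Pi.single j 1) (by simp)
    simp only [Pi.sub_apply, mul_sub, Finset.sum_sub_distrib, Pi.single_apply, mul_ite, mul_one,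
      mul_zero, Finset.sum_ite_eq', Finset.mem_univ, if_true] at key
    rw [hC.2.2 i, hC.2.2 j, hC.2.1 j i] at key
    unfold Gmat
    linarith
  refine ⟨fun i j => ?_, hG⟩
  have h := hC.1 i j
  rw [hG, Gmat] at h
  linarith [nonneg_of_mul_nonneg_right h (half_pos hγ)]

end IOT
end

section
/- (Non-injectivity of the forward map when the observed plan is sparse.) Assume 0 ∈ I and that φ'_0 := lim_{x→0⁺} φ'(x) is finite. Let Ĉ ∈ ℝ^{n×n} and suppose X̂ is the unique minimizer of J_{Ĉ} over U_I(μ,ν), and that X̂_{pq} = 0 for some indices p,q. Then for every λ > 0, X̂ is also the unique minimizer of J_{Ĉ + λE^{(p,q)}} over U_I(μ,ν), where E^{(p,q)} ∈ ℝ^{n×n} is the matrix with entry 1 in position (p,q) and 0 elsewhere. -/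
open Filter Set Topology

namespace IOT
/-- Raising the cost of cell `(p, q)` by `lam` adds `lam * X p q` to the objective. -/
theorem JCost_add_single {n : ℕ} (γ : ℝ) (φ : ℝ → ℝ) (C X : Fin n → Fin n → ℝ)
    (p q : Fin n) (lam : ℝ) :
    JCost γ φ (fun i j => C i j + if i = p ∧ j = q then lam else 0) X =
      JCost γ φ C X + lam * X p q := by
  simp only [JCost, add_mul, Finset.sum_add_distrib, ite_and, ite_mul, zero_mul]
  simp [Finset.sum_ite_irrel, add_right_comm]

/-- non-injectivity of the forward map when the observed plan is sparse
and `φ'_0` is finite. -/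
theorem stmt10 {n : ℕ} (hn : 0 < n)
    (I : Set ℝ) (hIoc : I.OrdConnected) (hI01 : Set.Ioo (0:ℝ) 1 ⊆ interior I)
    (φ φ' : ℝ → ℝ)
    (hφcont : ContinuousOn φ I)
    (hφconv : ConvexOn ℝ I φ)
    (hφderiv : ∀ x ∈ interior I, HasDerivAt φ (φ' x) x)
    (hφ'cont : ContinuousOn φ' (interior I))
    (hφstrict : StrictConvexOn ℝ (interior I) φ)
    (h0I : (0:ℝ) ∈ I)
    (hφ'0fin : ∃ c : ℝ, Tendsto φ' (𝓝[>] (0:ℝ)) (𝓝 c))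
    (γ : ℝ) (hγ : 0 < γ)
    (μ ν : Fin n → ℝ) (hμ : ProbVec μ) (hν : ProbVec ν)
    (Ch : Fin n → Fin n → ℝ) (Xh : Fin n → Fin n → ℝ)
    (hmin : UniqueMin μ ν I γ φ Ch Xh)
    (p q : Fin n) (hpq : Xh p q = 0) :
    ∀ lam : ℝ, 0 < lam →
      UniqueMin μ ν I γ φ
        (fun i j => Ch i j + if i = p ∧ j = q then lam else 0) Xh := by
  intro lam hlam
  refine ⟨hmin.1, fun X hX hne => ?_⟩
  rw [JCost_add_single, JCost_add_single, hpq, mul_zero, add_zero]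
  exact (hmin.2 X hX hne).trans_le
    (le_add_of_nonneg_right (mul_nonneg hlam.le (hX.1.1 p q)))

end IOT
end

section
/- (A 2×2 example of non-uniqueness of the recovered cost under quadratic regularization.) Let 0 ≤ a ≤ b ≤ 1 and let γ ≥ max{1/2 + a − b, 0}. Set μ := (a, 1−a), ν := (b, 1−b), X̂ := [[a, 0], [b−a, 1−b]], and C := [[0, γ], [γ, 0]]. Then X̂ ∈ U(μ,ν) and X̂ is the unique minimizer over U(μ,ν) of the function X ↦ Σ_{i,j} C_{ij} X_{ij} + (1/2) Σ_{i,j} X_{ij}². -/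
open Filter Set Topology

namespace IOT
/-- a 2×2 example of non-uniqueness of the recovered cost under
quadratic regularization. -/
theorem stmt11 (a b γ : ℝ) (ha : 0 ≤ a) (hab : a ≤ b) (hb : b ≤ 1)
    (hγ : max (1/2 + a - b) 0 ≤ γ) :
    MemU ![a, 1-a] ![b, 1-b] ![![a, 0], ![b-a, 1-b]] ∧
    ∀ X : Fin 2 → Fin 2 → ℝ, MemU ![a, 1-a] ![b, 1-b] X →
      X ≠ ![![a, 0], ![b-a, 1-b]] →
      (∑ i, ∑ j, (![![(0:ℝ), γ], ![γ, 0]]) i j * (![![a, 0], ![b-a, 1-b]]) i j)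
          + (1/2) * ∑ i, ∑ j, ((![![a, 0], ![b-a, 1-b]]) i j)^2
        < (∑ i, ∑ j, (![![(0:ℝ), γ], ![γ, 0]]) i j * X i j)
          + (1/2) * ∑ i, ∑ j, (X i j)^2 := by
  have hγ' : 1/2 + a - b ≤ γ := (le_max_left _ _).trans hγ
  refine ⟨⟨?_, ?_, ?_⟩, ?_⟩
  · intro i j
    fin_cases i <;> fin_cases j <;> simp <;> linarith
  · intro i
    fin_cases i <;> simp [Fin.sum_univ_two]
  · intro j
    fin_cases j <;> simp [Fin.sum_univ_two]
  · rintro X ⟨hX, hrow, hcol⟩ hne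
    have ht : 0 ≤ X 0 1 := hX 0 1
    have hr := hrow 0
    have hc₀ := hcol 0
    have hc₁ := hcol 1
    simp only [Fin.sum_univ_two, Matrix.cons_val_zero, Matrix.cons_val_one] at hr hc₀ hc₁ ⊢
    have h00 : X 0 0 = a - X 0 1 := by linarith
    have h10 : X 1 0 = b - a + X 0 1 := by linarith
    have h11 : X 1 1 = 1 - b - X 0 1 := by linarith
    have hpos : 0 < X 0 1 := by
      refine lt_of_le_of_ne ht fun h0 => hne ?_
      ext i j
      fin_cases i <;> fin_cases j <;> simp [h00, h10, h11, ← h0]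
    rw [h00, h10, h11]
    nlinarith [mul_pos hpos hpos, mul_nonneg ht (sub_nonneg.2 hγ')]

end IOT
end

section
/- (Non-uniqueness of the cost even for multiple observed plans with jointly full support.) Let γ ≥ 0 and C := [[0, γ], [γ, 0]]. Set X₁ := [[1/4, 1/2], [0, 1/4]], X₂ := [[1/4, 0], [1/2, 1/4]], μ₁ = ν₂ := (3/4, 1/4), and ν₁ = μ₂ := (1/4, 3/4). Then X₁ ∈ U(μ₁,ν₁), X₂ ∈ U(μ₂,ν₂), X₁ is the unique minimizer over U(μ₁,ν₁) of X ↦ Σ_{i,j} C_{ij} X_{ij} + (1/2) Σ_{i,j} X_{ij}², and X₂ is the unique minimizer over U(μ₂,ν₂) of the same function; moreover every pair (i,j) with 1 ≤ i,j ≤ 2 lies in the support of X₁ or of X₂. -/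
open Filter Set Topology

namespace IOT
/-- In terms of the entries `a, b, c, d` of a `2 × 2` plan with `a = d = 1/4 - c` and
`b = 1/2 + c`, the quadratically regularized cost exceeds that of the plan with `c = 0`. -/
lemma quadratic_cost_lt {γ a b c d : ℝ} (hγ : 0 ≤ γ) (hc : 0 < c)
    (ha : a = 1 / 4 - c) (hb : b = 1 / 2 + c) (hd : d = 1 / 4 - c) :
    γ * (1 / 2) + 1 / 2 * (3 / 8) <
      γ * (b + c) + 1 / 2 * (a ^ 2 + b ^ 2 + c ^ 2 + d ^ 2) := by
  subst ha hb hd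
  nlinarith [mul_nonneg hγ hc.le, pow_pos hc 2]

/-- non-uniqueness of the cost even for multiple observed plans
with jointly full support. -/
theorem stmt12 (γ : ℝ) (hγ : 0 ≤ γ) :
    MemU ![(3:ℝ)/4, 1/4] ![(1:ℝ)/4, 3/4] ![![(1:ℝ)/4, 1/2], ![0, 1/4]] ∧
    MemU ![(1:ℝ)/4, 3/4] ![(3:ℝ)/4, 1/4] ![![(1:ℝ)/4, 0], ![1/2, 1/4]] ∧
    (∀ X : Fin 2 → Fin 2 → ℝ, MemU ![(3:ℝ)/4, 1/4] ![(1:ℝ)/4, 3/4] X →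
      X ≠ ![![(1:ℝ)/4, 1/2], ![0, 1/4]] →
      (∑ i, ∑ j, (![![(0:ℝ), γ], ![γ, 0]]) i j * (![![(1:ℝ)/4, 1/2], ![0, 1/4]]) i j)
          + (1/2) * ∑ i, ∑ j, ((![![(1:ℝ)/4, 1/2], ![0, 1/4]]) i j)^2
        < (∑ i, ∑ j, (![![(0:ℝ), γ], ![γ, 0]]) i j * X i j)
          + (1/2) * ∑ i, ∑ j, (X i j)^2) ∧
    (∀ X : Fin 2 → Fin 2 → ℝ, MemU ![(1:ℝ)/4, 3/4] ![(3:ℝ)/4, 1/4] X →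
      X ≠ ![![(1:ℝ)/4, 0], ![1/2, 1/4]] →
      (∑ i, ∑ j, (![![(0:ℝ), γ], ![γ, 0]]) i j * (![![(1:ℝ)/4, 0], ![1/2, 1/4]]) i j)
          + (1/2) * ∑ i, ∑ j, ((![![(1:ℝ)/4, 0], ![1/2, 1/4]]) i j)^2
        < (∑ i, ∑ j, (![![(0:ℝ), γ], ![γ, 0]]) i j * X i j)
          + (1/2) * ∑ i, ∑ j, (X i j)^2) ∧
    (∀ i j : Fin 2, 0 < (![![(1:ℝ)/4, 1/2], ![0, 1/4]]) i j
        ∨ 0 < (![![(1:ℝ)/4, 0], ![1/2, 1/4]]) i j) := by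
  refine ⟨?_, ?_, ?_, ?_, ?_⟩
  · norm_num [MemU, Fin.forall_fin_two, Fin.sum_univ_two]
  · norm_num [MemU, Fin.forall_fin_two, Fin.sum_univ_two]
  · rintro X ⟨hX, hr, hs⟩ hne
    simp only [Fin.forall_fin_two, Fin.sum_univ_two, Matrix.cons_val_zero,
      Matrix.cons_val_one] at hr hs
    obtain ⟨hr₀, hr₁⟩ := hr
    obtain ⟨hs₀, hs₁⟩ := hs
    have hpos : 0 < X 1 0 := by
      refine (hX 1 0).lt_of_ne fun h ↦ hne ?_
      ext i j
      fin_cases i <;> fin_cases j <;> simp <;> linarith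
    have key := quadratic_cost_lt (a := X 0 0) (b := X 0 1) (c := X 1 0) (d := X 1 1)
      hγ hpos (by linarith) (by linarith) (by linarith)
    simp only [Fin.sum_univ_two, Matrix.cons_val_zero, Matrix.cons_val_one]
    linarith
  · rintro X ⟨hX, hr, hs⟩ hne
    simp only [Fin.forall_fin_two, Fin.sum_univ_two, Matrix.cons_val_zero,
      Matrix.cons_val_one] at hr hs
    obtain ⟨hr₀, hr₁⟩ := hr
    obtain ⟨hs₀, hs₁⟩ := hs
    have hpos : 0 < X 0 1 := by
      refine (hX 0 1).lt_of_ne fun h ↦ hne ?_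
      ext i j
      fin_cases i <;> fin_cases j <;> simp <;> linarith
    have key := quadratic_cost_lt (a := X 0 0) (b := X 1 0) (c := X 0 1) (d := X 1 1)
      hγ hpos (by linarith) (by linarith) (by linarith)
    simp only [Fin.sum_univ_two, Matrix.cons_val_zero, Matrix.cons_val_one]
    linarith
  · norm_num [Fin.forall_fin_two]

end IOT
end

section
/- (Equivalence of the bilevel inverse problem with a single-level convex problem.) Let μ, ν ∈ ℝ^n be probability vectors and let X̂ ∈ U(μ,ν) have every entry in int(I). Let C ∈ ℝ^{n×n}, and suppose X^C ∈ U(μ,ν) has every entry in int(I) and there exist u^C, v^C ∈ ℝ^n with γ φ'(X^C_{ij}) = u^C_i + v^C_j − C_{ij} for all i,j. Then: (i) for every u, v ∈ ℝ^n such that (u_i + v_j − C_{ij})/γ ∈ J for all i,j, one has E(u, v, C) ≥ E(u^C, v^C, C); and (ii) Σ_{i,j} B_φ(X̂_{ij} ‖ X^C_{ij}) = E(u^C, v^C, C) + Σ_{i,j} φ(X̂_{ij}). -/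
open Filter Set Topology

namespace IOT
/-- The single-level objective `E(u,v,C)` for observed plan `Xh`,
with `ψ` the Fenchel conjugate of `φ`. -/
noncomputable def Efun {n : ℕ} (γ : ℝ) (ψ : ℝ → ℝ) (Xh : Fin n → Fin n → ℝ)
    (u v : Fin n → ℝ) (C : Fin n → Fin n → ℝ) : ℝ :=
  ∑ i, ∑ j, (ψ ((u i + v j - C i j) / γ) - ((u i + v j - C i j) / γ) * Xh i j)

/-- A convex function lies above its tangent line, i.e. the Bregman divergence is nonnegative. -/
theorem breg_nonneg {S : Set ℝ} {φ φ' : ℝ → ℝ} (hφ : ConvexOn ℝ S φ) {x y : ℝ}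
    (hx : x ∈ S) (hy : y ∈ S) (hd : HasDerivAt φ (φ' y) y) : 0 ≤ Breg φ φ' x y := by
  unfold Breg
  rcases lt_trichotomy x y with h | rfl | h
  · have := hφ.slope_le_of_hasDerivAt hx hy h hd
    rw [slope_def_field, div_le_iff₀ (by linarith)] at this
    linarith
  · simp
  · have := hφ.le_slope_of_hasDerivAt hy hx h hd
    rw [slope_def_field, le_div_iff₀ (by linarith)] at this
    linarith

/-- Pairing a dual potential `u ⊕ v` with the difference of two plans having the same marginals
gives zero. -/
theorem sum_potential_mul_sub_eq_zero {n : ℕ} {μ ν : Fin n → ℝ} {X Y : Fin n → Fin n → ℝ}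
    (hX : MemU μ ν X) (hY : MemU μ ν Y) (u v : Fin n → ℝ) :
    ∑ i, ∑ j, (u i + v j) * (X i j - Y i j) = 0 := by
  have hu : ∑ i, ∑ j, u i * (X i j - Y i j) = 0 :=
    Finset.sum_eq_zero fun i _ => by
      rw [← Finset.mul_sum, Finset.sum_sub_distrib, hX.2.1, hY.2.1, sub_self, mul_zero]
  have hv : ∑ i, ∑ j, v j * (X i j - Y i j) = 0 := by
    rw [Finset.sum_comm]
    exact Finset.sum_eq_zero fun j _ => by
      rw [← Finset.mul_sum, Finset.sum_sub_distrib, hX.2.2, hY.2.2, sub_self, mul_zero]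
  simp only [add_mul, Finset.sum_add_distrib, hu, hv, add_zero]

/-- equivalence of the bilevel inverse problem with a single-level
convex problem.  Here `g` is the inverse of `φ'` on `interior I`,
`J = φ' '' (interior I)` and `ψ θ = θ * g θ - φ (g θ)`. -/
theorem stmt14 {n : ℕ} (hn : 0 < n)
    (I : Set ℝ) (hIoc : I.OrdConnected) (hI01 : Set.Ioo (0:ℝ) 1 ⊆ interior I)
    (φ φ' : ℝ → ℝ)
    (hφcont : ContinuousOn φ I)
    (hφconv : ConvexOn ℝ I φ)
    (hφderiv : ∀ x ∈ interior I, HasDerivAt φ (φ' x) x)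
    (hφ'cont : ContinuousOn φ' (interior I))
    (hφstrict : StrictConvexOn ℝ (interior I) φ)
    (γ : ℝ) (hγ : 0 < γ)
    (μ ν : Fin n → ℝ) (hμ : ProbVec μ) (hν : ProbVec ν)
    (g : ℝ → ℝ) (hg : ∀ x ∈ interior I, g (φ' x) = x)
    (Xh : Fin n → Fin n → ℝ) (hXhU : MemU μ ν Xh)
    (hXhI : ∀ i j, Xh i j ∈ interior I)
    (C : Fin n → Fin n → ℝ)
    (XC : Fin n → Fin n → ℝ) (hXCU : MemU μ ν XC)
    (hXCI : ∀ i j, XC i j ∈ interior I)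
    (uC vC : Fin n → ℝ)
    (hKKT : ∀ i j, γ * φ' (XC i j) = uC i + vC j - C i j) :
    (∀ u v : Fin n → ℝ,
      (∀ i j, (u i + v j - C i j) / γ ∈ φ' '' (interior I)) →
        Efun γ (fun θ => θ * g θ - φ (g θ)) Xh uC vC C
          ≤ Efun γ (fun θ => θ * g θ - φ (g θ)) Xh u v C) ∧
    (∑ i, ∑ j, Breg φ φ' (Xh i j) (XC i j))
      = Efun γ (fun θ => θ * g θ - φ (g θ)) Xh uC vC C + ∑ i, ∑ j, φ (Xh i j) := by
  have hθ : ∀ i j, (uC i + vC j - C i j) / γ = φ' (XC i j) := fun i j => by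
    rw [← hKKT, mul_div_cancel_left₀ _ hγ.ne']
  refine ⟨fun u v huv => ?_, ?_⟩
  · have hle : ∀ i j, ((u i + v j - C i j) / γ - (uC i + vC j - C i j) / γ)
          * (XC i j - Xh i j)
        ≤ ((u i + v j - C i j) / γ * g ((u i + v j - C i j) / γ)
            - φ (g ((u i + v j - C i j) / γ)) - (u i + v j - C i j) / γ * Xh i j)
          - ((uC i + vC j - C i j) / γ * g ((uC i + vC j - C i j) / γ)
            - φ (g ((uC i + vC j - C i j) / γ)) - (uC i + vC j - C i j) / γ * Xh i j) := by
      intro i j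
      obtain ⟨x, hx, hxθ⟩ := huv i j
      have hB := breg_nonneg hφstrict.convexOn (hXCI i j) hx (hφderiv x hx)
      unfold Breg at hB
      rw [hθ, ← hxθ, hg x hx, hg _ (hXCI i j)]
      linarith
    have hzero : ∑ i, ∑ j, ((u i + v j - C i j) / γ - (uC i + vC j - C i j) / γ)
        * (XC i j - Xh i j) = 0 := by
      rw [← sum_potential_mul_sub_eq_zero hXCU hXhU
        (fun i => (u i - uC i) / γ) (fun j => (v j - vC j) / γ)]
      refine Finset.sum_congr rfl fun i _ => Finset.sum_congr rfl fun j _ => ?_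
      ring
    have hsum := Finset.sum_le_sum fun i (_ : i ∈ Finset.univ) =>
      Finset.sum_le_sum fun j (_ : j ∈ Finset.univ) => hle i j
    rw [hzero] at hsum
    simpa only [Efun, Finset.sum_sub_distrib, sub_nonneg] using hsum
  · simp only [Efun, ← Finset.sum_add_distrib]
    refine Finset.sum_congr rfl fun i _ => Finset.sum_congr rfl fun j _ => ?_
    rw [hθ, hg _ (hXCI i j), Breg]
    ring

end IOT
end

section
/- (Existence and uniqueness for the single-level problem over symmetric zero-diagonal costs.) Let φ : ℝ → ℝ ∪ {+∞} be proper, convex, and lower semicontinuous, with dom φ := {x ∈ ℝ : φ(x) < +∞}, and define ψ : ℝ → ℝ ∪ {+∞} by ψ(θ) := sup_{x ∈ ℝ} (θx − φ(x)). Fix an integer n ≥ 1, γ > 0, and X̂ ∈ ℝ^{n×n} with X̂_{ij} ∈ int(dom φ) for all i,j. For u, v ∈ ℝ^n and C ∈ ℝ^{n×n}, define E(u, v, C) := Σ_{i,j} [ψ((u_i + v_j − C_{ij})/γ) − ((u_i + v_j − C_{ij})/γ)·X̂_{ij}] ∈ ℝ ∪ {+∞}. Then the infimum of E over (u, v, C)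 ∈ ℝ^n × ℝ^n × S_h is finite and is attained at some (u*, v*, C*). Moreover, if at some minimizer (u*, v*, C*) the function ψ is finite and twice differentiable on a neighborhood of each point (u*_i + v*_j − C*_{ij})/γ with ψ''((u*_i + v*_j − C*_{ij})/γ) > 0 for all i,j, then the optimal cost matrix is unique: every minimizer (u, v, C) of E over ℝ^n × ℝ^n × S_h satisfies C = C*. -/
open Filter Set Topology

namespace IOT15

/-- Membership in `S_h`: nonnegative, symmetric, zero diagonal. -/
def MemSh {n : ℕ} (C : Fin n → Fin n → ℝ) : Prop :=
  (∀ i j, 0 ≤ C i j) ∧ (∀ i j, C i j = C j i) ∧ (∀ i, C i i = 0)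

/-- The Fenchel conjugate `ψ(θ) = sup_x (θx - φ(x))` of the extended function
equal to `φ` on `D` and `+∞` off `D`, with values in `EReal`. -/
noncomputable def psi (D : Set ℝ) (φ : ℝ → ℝ) (θ : ℝ) : EReal :=
  ⨆ x ∈ D, ((θ * x - φ x : ℝ) : EReal)

/-- The single-level objective `E(u,v,C)` with values in `EReal`. -/
noncomputable def Efun {n : ℕ} (γ : ℝ) (D : Set ℝ) (φ : ℝ → ℝ)
    (Xh : Fin n → Fin n → ℝ) (u v : Fin n → ℝ) (C : Fin n → Fin n → ℝ) : EReal :=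
  ∑ i, ∑ j,
    (psi D φ ((u i + v j - C i j) / γ)
      + ((-(((u i + v j - C i j) / γ) * Xh i j) : ℝ) : EReal))

section ERealSums

variable {ι : Type*}

theorem coe_finset_sum_ereal (s : Finset ι) (f : ι → ℝ) :
    ((∑ i ∈ s, f i : ℝ) : EReal) = ∑ i ∈ s, (f i : EReal) := by
  classical
  induction s using Finset.induction_on with
  | empty => simp
  | insert a s ha ih => rw [Finset.sum_insert ha, Finset.sum_insert ha, EReal.coe_add, ih]

theorem sum_ne_bot_ereal {s : Finset ι} {f : ι → EReal} (h : ∀ i ∈ s, f i ≠ ⊥) :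
    ∑ i ∈ s, f i ≠ ⊥ := by
  classical
  induction s using Finset.induction_on with
  | empty => simp
  | insert a s ha ih =>
    rw [Finset.sum_insert ha, EReal.add_ne_bot_iff]
    exact ⟨h a (Finset.mem_insert_self a s), ih fun i hi => h i (Finset.mem_insert_of_mem hi)⟩

theorem ne_top_of_sum_ne_top_ereal {s : Finset ι} {f : ι → EReal} (h : ∀ i ∈ s, f i ≠ ⊥)
    (hs : ∑ i ∈ s, f i ≠ ⊤) {i : ι} (hi : i ∈ s) : f i ≠ ⊤ := by
  classical
  rw [← Finset.add_sum_erase s f hi, EReal.add_ne_top_iff_ne_top₂ (h i hi)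
    (sum_ne_bot_ereal fun j hj => h j (Finset.mem_of_mem_erase hj))] at hs
  exact hs.1

theorem lowerSemicontinuous_sum_ereal {α : Type*} [TopologicalSpace α] {s : Finset ι}
    {f : ι → α → EReal} (hf : ∀ i ∈ s, LowerSemicontinuous (f i))
    (h : ∀ i ∈ s, ∀ x, f i x ≠ ⊥) : LowerSemicontinuous fun x => ∑ i ∈ s, f i x := by
  classical
  induction s using Finset.induction_on with
  | empty => simpa using lowerSemicontinuous_const
  | insert a s ha ih =>
    simp only [Finset.sum_insert ha]
    refine LowerSemicontinuous.add' (hf a (Finset.mem_insert_self a s))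
      (ih (fun i hi => hf i (Finset.mem_insert_of_mem hi))
        fun i hi => h i (Finset.mem_insert_of_mem hi)) fun x => ?_
    exact EReal.continuousAt_add
      (.inr (sum_ne_bot_ereal fun i hi => h i (Finset.mem_insert_of_mem hi) x))
      (.inl (h a (Finset.mem_insert_self a s) x))

end ERealSums

/-- A convex function on a subset of `ℝ` has a subgradient at every interior point. -/
theorem exists_subgradient_of_mem_interior {D : Set ℝ} {φ : ℝ → ℝ} (hconv : ConvexOn ℝ D φ)
    {x : ℝ} (hx : x ∈ interior D) : ∃ m : ℝ, ∀ y ∈ D, φ x + m * (y - x) ≤ φ y := by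
  refine ⟨derivWithin φ (Ioi x) x, fun y hy => ?_⟩
  rcases lt_trichotomy x y with hxy | rfl | hxy
  · have := hconv.rightDeriv_le_slope_of_mem_interior hx hy hxy
    rw [slope_def_field, le_div_iff₀ (sub_pos.2 hxy)] at this
    linarith
  · simp
  · have h1 := hconv.slope_le_leftDeriv_of_mem_interior hy hx hxy
    have h2 := h1.trans (hconv.leftDeriv_le_rightDeriv_of_mem_interior hx)
    rw [slope_def_field, div_le_iff₀ (sub_pos.2 hxy)] at h2
    linarith

section Conjugate

variable {D : Set ℝ} {φ : ℝ → ℝ}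

theorem coe_le_psi {x : ℝ} (hx : x ∈ D) (θ : ℝ) : ((θ * x - φ x : ℝ) : EReal) ≤ psi D φ θ :=
  le_iSup₂_of_le x hx le_rfl

theorem psi_ne_bot (hD : D.Nonempty) (θ : ℝ) : psi D φ θ ≠ ⊥ := by
  obtain ⟨x, hx⟩ := hD
  exact ne_bot_of_le_ne_bot (EReal.coe_ne_bot _) (coe_le_psi hx θ)

theorem psi_le_coe_iff {θ a : ℝ} : psi D φ θ ≤ a ↔ ∀ x ∈ D, θ * x - φ x ≤ a := by
  simp only [psi, iSup_le_iff, EReal.coe_le_coe_iff]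

theorem lowerSemicontinuous_psi : LowerSemicontinuous (psi D φ) :=
  lowerSemicontinuous_biSup fun x _ => Continuous.lowerSemicontinuous <|
    continuous_coe_real_ereal.comp (by fun_prop : Continuous fun θ : ℝ => θ * x - φ x)

theorem psi_convex {θ₀ θ₁ a b t : ℝ} (h₀ : psi D φ θ₀ ≤ a) (h₁ : psi D φ θ₁ ≤ b)
    (ht₀ : 0 ≤ t) (ht₁ : t ≤ 1) :
    psi D φ (θ₀ + t * (θ₁ - θ₀)) ≤ (((1 - t) * a + t * b : ℝ) : EReal) := by
  rw [psi_le_coe_iff] at *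
  intro x hx
  have := mul_le_mul_of_nonneg_left (h₀ x hx) (sub_nonneg.2 ht₁)
  have := mul_le_mul_of_nonneg_left (h₁ x hx) ht₀
  linarith

theorem psi_ne_top_of_subgradient {x m : ℝ} (h : ∀ y ∈ D, φ x + m * (y - x) ≤ φ y) :
    psi D φ m ≠ ⊤ := by
  have : psi D φ m ≤ ((m * x - φ x : ℝ) : EReal) :=
    psi_le_coe_iff.2 fun y hy => by linarith [h y hy]
  exact ne_top_of_le_ne_top (EReal.coe_ne_top _) this

/-- The conjugate tilted by an interior point of the domain is coercive. -/
theorem exists_coercive_bound {x : ℝ} (hx : x ∈ interior D) : ∃ ε > 0, ∃ M : ℝ, ∀ θ : ℝ,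
    ((ε * |θ| - M : ℝ) : EReal) ≤ psi D φ θ + ((-(θ * x) : ℝ) : EReal) := by
  obtain ⟨ε, hε, hball⟩ := Metric.mem_nhds_iff.1 (mem_interior_iff_mem_nhds.1 hx)
  have h₁ : x + ε / 2 ∈ D := hball (by
    rw [Metric.mem_ball, Real.dist_eq, add_sub_cancel_left, abs_of_pos] <;> linarith)
  have h₂ : x - ε / 2 ∈ D := hball (by
    rw [Metric.mem_ball, Real.dist_eq, abs_sub_comm, sub_sub_cancel, abs_of_pos] <;> linarith)
  refine ⟨ε / 2, half_pos hε, max (φ (x + ε / 2)) (φ (x - ε / 2)), fun θ => ?_⟩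
  have key : ∀ y ∈ D, ε / 2 * |θ| - max (φ (x + ε / 2)) (φ (x - ε / 2)) ≤
      θ * y - φ y + -(θ * x) → ((ε / 2 * |θ| - max (φ (x + ε / 2)) (φ (x - ε / 2)) : ℝ) : EReal) ≤
      psi D φ θ + ((-(θ * x) : ℝ) : EReal) := fun y hy h =>
    (EReal.coe_le_coe_iff.2 h).trans (by
      rw [EReal.coe_add]; exact add_le_add_left (coe_le_psi hy θ) _)
  rcases le_total 0 θ with h | h
  · refine key _ h₁ ?_
    rw [abs_of_nonneg h]
    linarith [le_max_left (φ (x + ε / 2)) (φ (x - ε / 2))]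
  · refine key _ h₂ ?_
    rw [abs_of_nonpos h]
    linarith [le_max_right (φ (x + ε / 2)) (φ (x - ε / 2))]

end Conjugate

/-- A function affine on a one-sided neighbourhood cannot have positive second derivative at the
endpoint, in any nonzero direction. -/
theorem direction_eq_zero_of_affine {f f' f'' : ℝ → ℝ} {x δ K : ℝ} {U : Set ℝ} (hU : U ∈ 𝓝 x)
    (hf : ∀ y ∈ U, HasDerivAt f (f' y) y) (hf' : HasDerivAt f' (f'' x) x) (hpos : 0 < f'' x)
    (haff : ∀ t, 0 < t → t < 1 → x + t * δ ∈ U → f (x + t * δ) = f x + t * K) : δ = 0 := by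
  have hline : ∀ t : ℝ, HasDerivAt (fun s : ℝ => x + s * δ) δ t := fun t => by
    simpa using ((hasDerivAt_id t).mul_const δ).const_add x
  have hcont : Tendsto (fun s : ℝ => x + s * δ) (𝓝 0) (𝓝 x) := by
    simpa using (hline 0).continuousAt.tendsto
  have hf'0 : HasDerivAt f' (f'' x) (x + 0 * δ) := by simpa using hf'
  have hg : HasDerivAt (fun s : ℝ => f' (x + s * δ) * δ) (f'' x * δ * δ) 0 :=
    (hf'0.comp (0 : ℝ) (hline 0)).mul_const δ
  have hev : ∀ᶠ t in 𝓝[>] (0 : ℝ), f' (x + t * δ) * δ = K := by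
    have h1 : ∀ᶠ t in 𝓝 (0 : ℝ), ∀ᶠ s in 𝓝 t, x + s * δ ∈ U :=
      (hcont.eventually hU).eventually_nhds
    filter_upwards [h1.filter_mono nhdsWithin_le_nhds, Ioo_mem_nhdsGT (zero_lt_one' ℝ)]
      with t ht ht01
    have hd : HasDerivAt (fun s : ℝ => f (x + s * δ)) (f' (x + t * δ) * δ) t :=
      (hf _ ht.self_of_nhds).comp t (hline t)
    have hd' : HasDerivAt (fun s : ℝ => f x + s * K) K t := by
      simpa using ((hasDerivAt_id t).mul_const K).const_add (f x)
    refine hd.unique (hd'.congr_of_eventuallyEq ?_)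
    filter_upwards [ht, Ioo_mem_nhds ht01.1 ht01.2] with s hs hs01
    exact haff s hs01.1 hs01.2 hs
  have hK : f' (x + 0 * δ) * δ = K :=
    tendsto_nhds_unique (hg.continuousAt.tendsto.mono_left nhdsWithin_le_nhds)
      (tendsto_const_nhds.congr' (hev.mono fun _ h => h.symm))
  have hz : HasDerivWithinAt (fun s : ℝ => f' (x + s * δ) * δ) 0 (Ioi 0) 0 :=
    (hasDerivWithinAt_const (0 : ℝ) (Ioi 0) K).congr_of_eventuallyEq hev hK
  have := (uniqueDiffWithinAt_Ioi (0 : ℝ)).eq_deriv _ hg.hasDerivWithinAt hz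
  rw [mul_assoc] at this
  exact mul_self_eq_zero.1 ((mul_eq_zero.1 this).resolve_left hpos.ne')

section Objective

variable {n : ℕ} {γ : ℝ} {D : Set ℝ} {φ : ℝ → ℝ} {Xh : Fin n → Fin n → ℝ}

theorem Efun_eq_coe {u v : Fin n → ℝ} {C : Fin n → Fin n → ℝ} {a : Fin n → Fin n → ℝ}
    (ha : ∀ i j, psi D φ ((u i + v j - C i j) / γ) = a i j) :
    Efun γ D φ Xh u v C =
      ((∑ i, ∑ j, (a i j - (u i + v j - C i j) / γ * Xh i j) : ℝ) : EReal) := by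
  simp only [Efun, ha, coe_finset_sum_ereal]
  simp only [sub_eq_add_neg (G := ℝ) (a _ _), EReal.coe_add]

theorem term_ne_bot (hD : D.Nonempty) (θ r : ℝ) : psi D φ θ + (r : EReal) ≠ ⊥ :=
  EReal.add_ne_bot_iff.2 ⟨psi_ne_bot hD θ, EReal.coe_ne_bot r⟩

theorem Efun_ne_bot (hD : D.Nonempty) (u v : Fin n → ℝ) (C : Fin n → Fin n → ℝ) :
    Efun γ D φ Xh u v C ≠ ⊥ :=
  sum_ne_bot_ereal fun _ _ => sum_ne_bot_ereal fun _ _ => term_ne_bot hD _ _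

theorem psi_ne_top_of_Efun_ne_top (hD : D.Nonempty) {u v : Fin n → ℝ} {C : Fin n → Fin n → ℝ}
    (h : Efun γ D φ Xh u v C ≠ ⊤) (i j : Fin n) : psi D φ ((u i + v j - C i j) / γ) ≠ ⊤ := by
  have h1 := ne_top_of_sum_ne_top_ereal
    (fun _ _ => sum_ne_bot_ereal fun _ _ => term_ne_bot hD _ _) h (Finset.mem_univ i)
  have h2 := ne_top_of_sum_ne_top_ereal (fun _ _ => term_ne_bot hD _ _) h1 (Finset.mem_univ j)
  exact ((EReal.add_ne_top_iff_ne_top₂ (psi_ne_bot hD _) (EReal.coe_ne_bot _)).1 h2).1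

theorem lowerSemicontinuous_Efun (hD : D.Nonempty) :
    LowerSemicontinuous fun p : (Fin n → ℝ) × (Fin n → ℝ) × (Fin n → Fin n → ℝ) =>
      Efun γ D φ Xh p.1 p.2.1 p.2.2 := by
  refine lowerSemicontinuous_sum_ereal (fun i _ => lowerSemicontinuous_sum_ereal (fun j _ => ?_)
    fun _ _ _ => term_ne_bot hD _ _) fun _ _ _ => sum_ne_bot_ereal fun _ _ => term_ne_bot hD _ _
  refine LowerSemicontinuous.add' (lowerSemicontinuous_psi.comp (by fun_prop))
    (continuous_coe_real_ereal.comp (by fun_prop)).lowerSemicontinuous fun p => ?_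
  exact EReal.continuousAt_add (.inr (EReal.coe_ne_bot _)) (.inr (EReal.coe_ne_top _))

/-- On a sublevel set of the objective all the dual arguments are uniformly bounded. -/
theorem exists_bound_of_Efun_le (hγ : 0 < γ) (hXh : ∀ i j, Xh i j ∈ interior D) (B : ℝ) :
    ∃ R, 0 ≤ R ∧ ∀ (u v : Fin n → ℝ) (C : Fin n → Fin n → ℝ), Efun γ D φ Xh u v C ≤ B →
      ∀ i j, |u i + v j - C i j| ≤ R := by
  choose ε hε M hM using fun i j => exists_coercive_bound (φ := φ) (hXh i j)
  have hMn : 0 ≤ |B| + ∑ k, ∑ l, |M k l| := by positivity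
  refine ⟨∑ i, ∑ j, γ * ((|B| + ∑ k, ∑ l, |M k l|) / ε i j),
    Finset.sum_nonneg fun i _ => Finset.sum_nonneg fun j _ =>
      mul_nonneg hγ.le (div_nonneg hMn (hε i j).le), fun u v C hE i j => ?_⟩
  have hsum : ∑ i, ∑ j, (ε i j * |(u i + v j - C i j) / γ| - M i j) ≤ B := by
    rw [← EReal.coe_le_coe_iff]
    refine le_trans ?_ hE
    simp only [coe_finset_sum_ereal]
    exact Finset.sum_le_sum fun i _ => Finset.sum_le_sum fun j _ => hM i j _
  simp only [Finset.sum_sub_distrib] at hsum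
  have h1 : ε i j * |(u i + v j - C i j) / γ| ≤
      ∑ i, ∑ j, ε i j * |(u i + v j - C i j) / γ| := by
    have hnn : ∀ i j, 0 ≤ ε i j * |(u i + v j - C i j) / γ| := fun i j =>
      mul_nonneg (hε i j).le (abs_nonneg _)
    exact (Finset.single_le_sum (f := fun j => ε i j * |(u i + v j - C i j) / γ|)
      (fun j _ => hnn i j) (Finset.mem_univ j)).trans
      (Finset.single_le_sum (f := fun i => ∑ j, ε i j * |(u i + v j - C i j) / γ|)
      (fun i _ => Finset.sum_nonneg fun j _ => hnn i j) (Finset.mem_univ i))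
  have h2 : ∑ i, ∑ j, M i j ≤ ∑ k, ∑ l, |M k l| :=
    Finset.sum_le_sum fun i _ => Finset.sum_le_sum fun j _ => le_abs_self _
  have h3 : |(u i + v j - C i j) / γ| ≤ (|B| + ∑ k, ∑ l, |M k l|) / ε i j := by
    rw [le_div_iff₀ (hε i j)]
    linarith [le_abs_self B]
  rw [abs_div, abs_of_pos hγ, div_le_iff₀ hγ, mul_comm] at h3
  have hnn : ∀ i j, 0 ≤ γ * ((|B| + ∑ k, ∑ l, |M k l|) / ε i j) := fun i j =>
    mul_nonneg hγ.le (div_nonneg hMn (hε i j).le)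
  exact h3.trans <| (Finset.single_le_sum
      (f := fun j => γ * ((|B| + ∑ k, ∑ l, |M k l|) / ε i j))
      (fun j _ => hnn i j) (Finset.mem_univ j)).trans
      (Finset.single_le_sum (f := fun i => ∑ j, γ * ((|B| + ∑ k, ∑ l, |M k l|) / ε i j))
      (fun i _ => Finset.sum_nonneg fun j _ => hnn i j) (Finset.mem_univ i))

/-- Normalized feasible triples with bounded dual arguments form a compact set. -/
theorem isCompact_normalized (i₀ : Fin n) {R : ℝ} (hR : 0 ≤ R) :
    IsCompact {p : (Fin n → ℝ) × (Fin n → ℝ) × (Fin n → Fin n → ℝ) |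
      p.1 i₀ = 0 ∧ MemSh p.2.2 ∧ ∀ i j, |p.1 i + p.2.1 j - p.2.2 i j| ≤ R} := by
  refine (isCompact_closedBall (0 : (Fin n → ℝ) × (Fin n → ℝ) × (Fin n → Fin n → ℝ))
    (6 * R)).of_isClosed_subset ?_ ?_
  · simp only [MemSh, ofPred_and, ofPred_forall]
    refine (isClosed_eq (by fun_prop) (by fun_prop)).inter
      (((isClosed_iInter fun i => isClosed_iInter fun j =>
        isClosed_le (by fun_prop) (by fun_prop)).inter
      ((isClosed_iInter fun i => isClosed_iInter fun j =>
        isClosed_eq (by fun_prop) (by fun_prop)).inter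
      (isClosed_iInter fun i => isClosed_eq (by fun_prop) (by fun_prop)))).inter
      (isClosed_iInter fun i => isClosed_iInter fun j =>
        isClosed_le (by fun_prop) (by fun_prop)))
  · rintro ⟨u, v, C⟩ ⟨hu, ⟨hC0, hCs, hCd⟩, hb⟩
    simp only [abs_le] at hu hC0 hCs hCd hb
    have hC : ∀ i j, C i j ≤ 2 * R := fun i j => by
      linarith [hb i i, hb j j, hb i j, hb j i, hCs i j, hCd i, hCd j]
    have hv : ∀ j, -R ≤ v j ∧ v j ≤ 3 * R := fun j => by
      constructor <;> linarith [hb i₀ j, hC i₀ j, hC0 i₀ j]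
    have hu' : ∀ i, -(4 * R) ≤ u i ∧ u i ≤ 4 * R := fun i => by
      constructor <;> linarith [hb i i₀, hC i i₀, hC0 i i₀, hv i₀]
    have h6 : 0 ≤ 6 * R := by linarith
    rw [mem_closedBall_zero_iff, Prod.norm_mk, Prod.norm_mk]
    refine max_le ((pi_norm_le_iff_of_nonneg h6).2 fun i => ?_)
      (max_le ((pi_norm_le_iff_of_nonneg h6).2 fun j => ?_)
        ((pi_norm_le_iff_of_nonneg h6).2 fun i => (pi_norm_le_iff_of_nonneg h6).2 fun j => ?_)) <;>
      rw [Real.norm_eq_abs, abs_le] <;> constructor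
    · linarith [hu' i]
    · linarith [hu' i]
    · linarith [hv j]
    · linarith [hv j]
    · linarith [hC0 i j]
    · linarith [hC i j]

theorem exists_minimizer (hn : 0 < n) (hD : D.Nonempty) (hconv : ConvexOn ℝ D φ) (hγ : 0 < γ)
    (hXh : ∀ i j, Xh i j ∈ interior D) :
    ∃ (ustar vstar : Fin n → ℝ) (Cstar : Fin n → Fin n → ℝ),
      MemSh Cstar ∧
      Efun γ D φ Xh ustar vstar Cstar ≠ ⊤ ∧
      Efun γ D φ Xh ustar vstar Cstar ≠ ⊥ ∧
      ∀ (u v : Fin n → ℝ) (C : Fin n → Fin n → ℝ), MemSh C →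
        Efun γ D φ Xh ustar vstar Cstar ≤ Efun γ D φ Xh u v C := by
  let i₀ : Fin n := ⟨0, hn⟩
  obtain ⟨m, hm⟩ := exists_subgradient_of_mem_interior hconv (hXh i₀ i₀)
  have hmt := psi_ne_top_of_subgradient hm
  have hE₀ := Efun_eq_coe (Xh := Xh) (γ := γ) (u := 0) (v := fun _ => γ * m) (C := 0)
    (D := D) (φ := φ) (a := fun _ _ => (psi D φ m).toReal) fun i j => by
      simp [hγ.ne', EReal.coe_toReal hmt (psi_ne_bot hD m)]
  set B : ℝ := ∑ i, ∑ j, ((psi D φ m).toReal -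
    ((0 : Fin n → ℝ) i + γ * m - (0 : Fin n → Fin n → ℝ) i j) / γ * Xh i j)
  obtain ⟨R, hR, hbound⟩ := exists_bound_of_Efun_le (φ := φ) hγ hXh B
  have hsh : MemSh (0 : Fin n → Fin n → ℝ) := by simp [MemSh]
  obtain ⟨⟨us, vs, Cs⟩, ⟨-, hCs, -⟩, hmin⟩ := LowerSemicontinuousOn.exists_isMinOn
    (s := {p : (Fin n → ℝ) × (Fin n → ℝ) × (Fin n → Fin n → ℝ) |
      p.1 i₀ = 0 ∧ MemSh p.2.2 ∧ ∀ i j, |p.1 i + p.2.1 j - p.2.2 i j| ≤ R})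
    ⟨(0, fun _ => γ * m, 0), rfl, hsh, hbound _ _ _ hE₀.le⟩ (isCompact_normalized i₀ hR)
    ((lowerSemicontinuous_Efun (γ := γ) (φ := φ) (Xh := Xh) hD).lowerSemicontinuousOn _)
  rw [isMinOn_iff] at hmin
  have hle : Efun γ D φ Xh us vs Cs ≤ B :=
    (hmin (0, fun _ => γ * m, 0) ⟨rfl, hsh, hbound _ _ _ hE₀.le⟩).trans hE₀.le
  refine ⟨us, vs, Cs, hCs, ne_top_of_le_ne_top (EReal.coe_ne_top _) hle, Efun_ne_bot hD _ _ _,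
    fun u v C hC => ?_⟩
  rcases le_total (Efun γ D φ Xh u v C) B with h | h
  · have hshift : Efun γ D φ Xh (fun i => u i - u i₀) (fun j => v j + u i₀) C =
        Efun γ D φ Xh u v C := by
      simp only [Efun, add_comm (v _) (u i₀), ← add_assoc, sub_add_cancel]
    rw [← hshift] at h ⊢
    exact hmin (_, _, C) ⟨sub_self _, hC, hbound _ _ _ h⟩
  · exact hle.trans h

theorem MemSh.segment {C₀ C₁ : Fin n → Fin n → ℝ} (h₀ : MemSh C₀) (h₁ : MemSh C₁) {t : ℝ}
    (ht₀ : 0 ≤ t) (ht₁ : t ≤ 1) : MemSh fun i j => C₀ i j + t * (C₁ i j - C₀ i j) := by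
  refine ⟨fun i j => ?_, fun i j => by simp only [h₀.2.1 i j, h₁.2.1 i j],
    fun i => by simp [h₀.2.2 i, h₁.2.2 i]⟩
  have := mul_nonneg (sub_nonneg.2 ht₁) (h₀.1 i j)
  have := mul_nonneg ht₀ (h₁.1 i j)
  linarith

/-- Along the segment joining two minimizers, each conjugate term is affine. -/
theorem psi_affine_between_minimizers (hD : D.Nonempty)
    {u₀ v₀ u₁ v₁ : Fin n → ℝ} {C₀ C₁ a b : Fin n → Fin n → ℝ} (h₀ : MemSh C₀) (h₁ : MemSh C₁)
    (hmin : ∀ (u v : Fin n → ℝ) (C : Fin n → Fin n → ℝ), MemSh C →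
      Efun γ D φ Xh u₀ v₀ C₀ ≤ Efun γ D φ Xh u v C)
    (heq : Efun γ D φ Xh u₀ v₀ C₀ = Efun γ D φ Xh u₁ v₁ C₁)
    (ha : ∀ i j, psi D φ ((u₀ i + v₀ j - C₀ i j) / γ) = a i j)
    (hb : ∀ i j, psi D φ ((u₁ i + v₁ j - C₁ i j) / γ) = b i j)
    {t : ℝ} (ht₀ : 0 ≤ t) (ht₁ : t ≤ 1) (i j : Fin n) :
    psi D φ ((u₀ i + v₀ j - C₀ i j) / γ +
      t * ((u₁ i + v₁ j - C₁ i j) / γ - (u₀ i + v₀ j - C₀ i j) / γ)) =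
      (((1 - t) * a i j + t * b i j : ℝ) : EReal) := by
  set θ₀ : Fin n → Fin n → ℝ := fun i j => (u₀ i + v₀ j - C₀ i j) / γ with hθ₀
  set θ₁ : Fin n → Fin n → ℝ := fun i j => (u₁ i + v₁ j - C₁ i j) / γ with hθ₁
  have hle : ∀ i j, psi D φ (θ₀ i j + t * (θ₁ i j - θ₀ i j)) ≤
      (((1 - t) * a i j + t * b i j : ℝ) : EReal) := fun i j =>
    psi_convex (ha i j).le (hb i j).le ht₀ ht₁
  have hcoe : ∀ i j, psi D φ (θ₀ i j + t * (θ₁ i j - θ₀ i j)) =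
      ((psi D φ (θ₀ i j + t * (θ₁ i j - θ₀ i j))).toReal : EReal) := fun i j =>
    (EReal.coe_toReal (ne_top_of_le_ne_top (EReal.coe_ne_top _) (hle i j))
      (psi_ne_bot hD _)).symm
  set c : Fin n → Fin n → ℝ := fun i j =>
    (psi D φ (θ₀ i j + t * (θ₁ i j - θ₀ i j))).toReal
  have hθ : ∀ i j, ((u₀ i + t * (u₁ i - u₀ i)) + (v₀ j + t * (v₁ j - v₀ j)) -
      (C₀ i j + t * (C₁ i j - C₀ i j))) / γ = θ₀ i j + t * (θ₁ i j - θ₀ i j) := fun i j => by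
    simp only [hθ₀, hθ₁]; ring
  have hEt := Efun_eq_coe (Xh := Xh) (γ := γ) (D := D) (φ := φ)
    (u := fun i => u₀ i + t * (u₁ i - u₀ i)) (v := fun j => v₀ j + t * (v₁ j - v₀ j))
    (C := fun i j => C₀ i j + t * (C₁ i j - C₀ i j)) (a := c) fun i j => by
      rw [hθ]; exact hcoe i j
  have hm := hmin (fun i => u₀ i + t * (u₁ i - u₀ i)) (fun j => v₀ j + t * (v₁ j - v₀ j)) _ (h₀.segment h₁ ht₀ ht₁)
  rw [hEt, Efun_eq_coe ha, EReal.coe_le_coe_iff] at hm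
  rw [Efun_eq_coe ha, Efun_eq_coe hb, EReal.coe_eq_coe_iff] at heq
  simp only [hθ] at hm
  have hcle : ∀ i j, c i j ≤ (1 - t) * a i j + t * b i j := fun i j => by
    rw [← EReal.coe_le_coe_iff, ← hcoe]; exact hle i j
  have hsum : ∑ p : Fin n × Fin n, ((1 - t) * a p.1 p.2 + t * b p.1 p.2 - c p.1 p.2) ≤ 0 := by
    have key : ∑ i, ∑ j, ((1 - t) * a i j + t * b i j - c i j) =
        (1 - t) * ∑ i, ∑ j, (a i j - θ₀ i j * Xh i j) +
        t * ∑ i, ∑ j, (b i j - θ₁ i j * Xh i j) -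
        ∑ i, ∑ j, (c i j - (θ₀ i j + t * (θ₁ i j - θ₀ i j)) * Xh i j) := by
      simp only [Finset.mul_sum, ← Finset.sum_add_distrib, ← Finset.sum_sub_distrib]
      exact Finset.sum_congr rfl fun i _ => Finset.sum_congr rfl fun j _ => by ring
    rw [Fintype.sum_prod_type, key, ← heq]
    linarith
  have hz := (Finset.sum_eq_zero_iff_of_nonneg fun (p : Fin n × Fin n) _ =>
    sub_nonneg.2 (hcle p.1 p.2)).1 (le_antisymm hsum (Finset.sum_nonneg fun p _ =>
    sub_nonneg.2 (hcle p.1 p.2))) (i, j) (Finset.mem_univ _)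
  refine (hcoe i j).trans ?_
  rw [EReal.coe_eq_coe_iff]
  exact (sub_eq_zero.1 hz).symm

theorem MemSh.eq_of_dual_eq {u₀ v₀ u₁ v₁ : Fin n → ℝ} {C₀ C₁ : Fin n → Fin n → ℝ}
    (h₀ : MemSh C₀) (h₁ : MemSh C₁)
    (h : ∀ i j, u₁ i + v₁ j - C₁ i j = u₀ i + v₀ j - C₀ i j) : C₁ = C₀ := by
  ext i j
  linarith [h i i, h j j, h i j, h j i, h₀.2.1 i j, h₁.2.1 i j, h₀.2.2 i, h₀.2.2 j, h₁.2.2 i,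
    h₁.2.2 j]

end Objective

/-- existence and uniqueness for the single-level problem over
symmetric zero-diagonal costs.  The proper closed convex function
`φ : ℝ → ℝ ∪ {+∞}` is encoded by its domain `D` and its real values `φ` on `D`:
properness is nonemptiness of `D`, convexity is `ConvexOn ℝ D φ`, and lower
semicontinuity is closedness of the epigraph. -/
theorem stmt15 {n : ℕ} (hn : 0 < n)
    (D : Set ℝ) (φ : ℝ → ℝ)
    (hproper : D.Nonempty)
    (hconv : ConvexOn ℝ D φ)
    (hlsc : IsClosed {p : ℝ × ℝ | p.1 ∈ D ∧ φ p.1 ≤ p.2})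
    (γ : ℝ) (hγ : 0 < γ)
    (Xh : Fin n → Fin n → ℝ) (hXh : ∀ i j, Xh i j ∈ interior D) :
    (∃ (ustar vstar : Fin n → ℝ) (Cstar : Fin n → Fin n → ℝ),
      MemSh Cstar ∧
      Efun γ D φ Xh ustar vstar Cstar ≠ ⊤ ∧
      Efun γ D φ Xh ustar vstar Cstar ≠ ⊥ ∧
      ∀ (u v : Fin n → ℝ) (C : Fin n → Fin n → ℝ), MemSh C →
        Efun γ D φ Xh ustar vstar Cstar ≤ Efun γ D φ Xh u v C) ∧
    (∀ (ustar vstar : Fin n → ℝ) (Cstar : Fin n → Fin n → ℝ), MemSh Cstar →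
      (∀ (u v : Fin n → ℝ) (C : Fin n → Fin n → ℝ), MemSh C →
        Efun γ D φ Xh ustar vstar Cstar ≤ Efun γ D φ Xh u v C) →
      (∃ ψr ψr' ψr'' : ℝ → ℝ, ∀ i j : Fin n, ∃ U : Set ℝ,
        U ∈ 𝓝 ((ustar i + vstar j - Cstar i j) / γ) ∧
        (∀ θ ∈ U, psi D φ θ = ((ψr θ : ℝ) : EReal)) ∧
        (∀ θ ∈ U, HasDerivAt ψr (ψr' θ) θ) ∧
        (∀ θ ∈ U, HasDerivAt ψr' (ψr'' θ) θ) ∧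
        0 < ψr'' ((ustar i + vstar j - Cstar i j) / γ)) →
      ∀ (u v : Fin n → ℝ) (C : Fin n → Fin n → ℝ), MemSh C →
        (∀ (u' v' : Fin n → ℝ) (C' : Fin n → Fin n → ℝ), MemSh C' →
          Efun γ D φ Xh u v C ≤ Efun γ D φ Xh u' v' C') →
        C = Cstar) := by
  refine ⟨exists_minimizer hn hproper hconv hγ hXh, ?_⟩
  rintro u₀ v₀ C₀ h₀ hmin₀ ⟨f, f', f'', hf⟩ u v C hC hmin
  have ha : ∀ i j, psi D φ ((u₀ i + v₀ j - C₀ i j) / γ) =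
      (f ((u₀ i + v₀ j - C₀ i j) / γ) : EReal) := fun i j => by
    obtain ⟨U, hU, hψ, -⟩ := hf i j
    exact hψ _ (mem_of_mem_nhds hU)
  have heq : Efun γ D φ Xh u₀ v₀ C₀ = Efun γ D φ Xh u v C :=
    le_antisymm (hmin₀ u v C hC) (hmin u₀ v₀ C₀ h₀)
  have hfin : Efun γ D φ Xh u v C ≠ ⊤ := by
    rw [← heq, Efun_eq_coe ha]
    exact EReal.coe_ne_top _
  have hb : ∀ i j, psi D φ ((u i + v j - C i j) / γ) =
      ((psi D φ ((u i + v j - C i j) / γ)).toReal : EReal) := fun i j =>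
    (EReal.coe_toReal (psi_ne_top_of_Efun_ne_top hproper hfin i j) (psi_ne_bot hproper _)).symm
  refine h₀.eq_of_dual_eq (u₀ := u₀) (v₀ := v₀) (u₁ := u) (v₁ := v) hC fun i j => ?_
  obtain ⟨U, hU, hψ, hd, hd', hpos⟩ := hf i j
  have hδ := direction_eq_zero_of_affine (δ := (u i + v j - C i j) / γ -
      (u₀ i + v₀ j - C₀ i j) / γ) (K := (psi D φ ((u i + v j - C i j) / γ)).toReal -
      f ((u₀ i + v₀ j - C₀ i j) / γ)) hU hd (hd' _ (mem_of_mem_nhds hU)) hpos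
    fun t ht₀ ht₁ htU => by
      have := psi_affine_between_minimizers hproper h₀ hC hmin₀ heq ha hb ht₀.le ht₁.le i j
      rw [hψ _ htU, EReal.coe_eq_coe_iff] at this
      rw [this]
      ring
  rw [← sub_div, div_eq_zero_iff] at hδ
  exact sub_eq_zero.1 (hδ.resolve_right hγ.ne')

end IOT15
end

section
/- (Convergence of the penalized problems as the penalty parameter tends to zero.) Let N ≥ 1, let D ⊆ ℝ^N be nonempty, closed and convex, let f : ℝ^N → ℝ be convex and continuous with S := {z ∈ D : f(z) ≤ f(z') for all z' ∈ D} nonempty, and let H : ℝ^N → ℝ be continuous and σ-strongly convex for some σ > 0. Then: (i) for every λ > 0 the function f + λH attains a unique minimizer z_λ over D; (ii) min_{z ∈ D} (f(z) + λH(z)) → min_{z ∈ D} f(z) as λ → 0⁺; and (iii) H attains a unique minimizer z₀ over S, and z_λ → z₀ as λ → 0⁺. -/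
open Filter Set Topology

section StrongConvexity

variable {E : Type*} [NormedAddCommGroup E] [NormedSpace ℝ E]

theorem StrongConvexOn.const_mul {s : Set E} {G : E → ℝ} {m c : ℝ}
    (hG : StrongConvexOn s m G) (hc : 0 ≤ c) :
    StrongConvexOn s (c * m) (fun x => c * G x) := by
  refine ⟨hG.1, fun x hx y hy a b ha hb hab => ?_⟩
  have h := mul_le_mul_of_nonneg_left (hG.2 hx hy ha hb hab) hc
  simp only [smul_eq_mul] at h ⊢
  linarith

theorem ConvexOn.add_strongConvexOn {s : Set E} {F G : E → ℝ} {m : ℝ}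
    (hF : ConvexOn ℝ s F) (hG : StrongConvexOn s m G) :
    StrongConvexOn s m (fun x => F x + G x) := by
  refine ⟨hF.1, fun x hx y hy a b ha hb hab => ?_⟩
  have h₁ := hF.2 hx hy ha hb hab
  have h₂ := hG.2 hx hy ha hb hab
  simp only [smul_eq_mul] at h₁ h₂ ⊢
  linarith

/-- A continuous strongly convex function on a proper space is coercive. -/
theorem StrongConvexOn.tendsto_cocompact_atTop [ProperSpace E] {G : E → ℝ} {m : ℝ}
    (hm : 0 < m) (hG : StrongConvexOn univ m G) (hcont : Continuous G) :
    Tendsto G (cocompact E) atTop := by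
  obtain ⟨p, -, hp⟩ := (isCompact_closedBall (0 : E) 1).exists_isMinOn
    ⟨0, by simp⟩ hcont.continuousOn
  have key : ∀ x : E, 1 ≤ ‖x‖ →
      G 0 + ‖x‖ * (m / 2 * ‖x‖ + (G p - G 0 - m / 2)) ≤ G x := by
    intro x hx
    have hr : 0 < ‖x‖ := by linarith
    have hinv : ‖x‖⁻¹ ≤ 1 := inv_le_one_of_one_le₀ hx
    have hball : ‖x‖⁻¹ • x ∈ Metric.closedBall (0 : E) 1 := by
      rw [mem_closedBall_zero_iff, norm_smul, norm_inv, norm_norm, inv_mul_cancel₀ hr.ne']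
    have h₁ : G p ≤ G (‖x‖⁻¹ • x) := hp hball
    have h₂ := hG.2 (mem_univ x) (mem_univ 0) (inv_nonneg.2 hr.le)
      (sub_nonneg.2 hinv) (by ring)
    simp only [smul_zero, add_zero, sub_zero, smul_eq_mul] at h₂
    have h₃ := mul_le_mul_of_nonneg_left (h₁.trans h₂) hr.le
    have h₄ : ‖x‖ * (‖x‖⁻¹ * G x + (1 - ‖x‖⁻¹) * G 0
        - ‖x‖⁻¹ * (1 - ‖x‖⁻¹) * (m / 2 * ‖x‖ ^ 2))
        = G x + (‖x‖ - 1) * G 0 - (‖x‖ - 1) * (m / 2 * ‖x‖) := by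
      field_simp
    rw [h₄] at h₃
    linarith
  have hnorm : Tendsto (fun x : E => ‖x‖) (cocompact E) atTop := tendsto_norm_cocompact_atTop
  refine tendsto_atTop_mono' _ ?_ (tendsto_atTop_add_const_left _ (G 0)
    (hnorm.atTop_mul_atTop₀ (tendsto_atTop_add_const_right _ (G p - G 0 - m / 2)
      (hnorm.const_mul_atTop (half_pos hm)))))
  filter_upwards [hnorm.eventually_ge_atTop 1] with x hx using key x hx

theorem StrongConvexOn.existsUnique_isMinOn [ProperSpace E] {G : E → ℝ} {m : ℝ}
    (hm : 0 < m) (hG : StrongConvexOn univ m G) (hcont : Continuous G) {C : Set E}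
    (hne : C.Nonempty) (hclosed : IsClosed C) (hconv : Convex ℝ C) :
    ∃! z, z ∈ C ∧ ∀ z' ∈ C, G z ≤ G z' := by
  obtain ⟨c, hc⟩ := hne
  obtain ⟨z, hz, hmin⟩ := hcont.continuousOn.exists_isMinOn' hclosed hc
    (((hG.tendsto_cocompact_atTop hm hcont).eventually_ge_atTop (G c)).filter_mono inf_le_left)
  refine ⟨z, ⟨hz, fun z' hz' => hmin hz'⟩, fun y hy => ?_⟩
  exact ((hG.strictConvexOn hm).subset (subset_univ C) hconv).eq_of_isMinOn
    (fun z' hz' => hy.2 z' hz') hmin hy.1 hz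

theorem StrongConvexOn.exists_forall_le [ProperSpace E] {G : E → ℝ} {m : ℝ}
    (hm : 0 < m) (hG : StrongConvexOn univ m G) (hcont : Continuous G) :
    ∃ p, ∀ x, G p ≤ G x := by
  obtain ⟨p, ⟨-, hp⟩, -⟩ := hG.existsUnique_isMinOn hm hcont ⟨0, mem_univ 0⟩ isClosed_univ
    convex_univ
  exact ⟨p, fun x => hp x (mem_univ x)⟩

theorem StrongConvexOn.isCompact_le [ProperSpace E] {G : E → ℝ} {m : ℝ}
    (hm : 0 < m) (hG : StrongConvexOn univ m G) (hcont : Continuous G) (c : ℝ) :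
    IsCompact {x | G x ≤ c} := by
  obtain ⟨K, hK, hsub⟩ := mem_cocompact.1
    ((hG.tendsto_cocompact_atTop hm hcont).eventually_gt_atTop c)
  refine hK.of_isClosed_subset (isClosed_le hcont continuous_const) fun x hx => ?_
  by_contra hxK
  have hlt : c < G x := hsub hxK
  exact hlt.not_ge hx

end StrongConvexity

/-- convergence of the penalized problems as the penalty parameter
tends to zero. -/
theorem stmt16 {N : ℕ} (hN : 1 ≤ N)
    (D : Set (EuclideanSpace ℝ (Fin N))) (hDne : D.Nonempty) (hDclosed : IsClosed D)
    (hDconv : Convex ℝ D)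
    (f : EuclideanSpace ℝ (Fin N) → ℝ)
    (hfconv : ConvexOn ℝ Set.univ f) (hfcont : Continuous f)
    (S : Set (EuclideanSpace ℝ (Fin N)))
    (hS : S = {z ∈ D | ∀ z' ∈ D, f z ≤ f z'}) (hSne : S.Nonempty)
    (H : EuclideanSpace ℝ (Fin N) → ℝ) (hHcont : Continuous H)
    (σ : ℝ) (hσ : 0 < σ) (hHstrong : StrongConvexOn Set.univ σ H) :
    (∀ lam : ℝ, 0 < lam →
      ∃! z : EuclideanSpace ℝ (Fin N),
        z ∈ D ∧ ∀ z' ∈ D, f z + lam * H z ≤ f z' + lam * H z') ∧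
    (∀ zfun : ℝ → EuclideanSpace ℝ (Fin N),
      (∀ lam : ℝ, 0 < lam →
        zfun lam ∈ D ∧ ∀ z' ∈ D, f (zfun lam) + lam * H (zfun lam) ≤ f z' + lam * H z') →
      (∀ z₀ ∈ S,
        Tendsto (fun lam => f (zfun lam) + lam * H (zfun lam)) (𝓝[>] (0:ℝ))
          (𝓝 (f z₀))) ∧
      (∃ z₀ ∈ S, (∀ z ∈ S, H z₀ ≤ H z) ∧
        (∀ z ∈ S, (∀ z' ∈ S, H z ≤ H z') → z = z₀) ∧
        Tendsto zfun (𝓝[>] (0:ℝ)) (𝓝 z₀))) := by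
  have hmemS : ∀ {z}, z ∈ S ↔ z ∈ D ∧ ∀ z' ∈ D, f z ≤ f z' := by
    intro z
    rw [hS, mem_ofPred_eq]
  refine ⟨fun lam hlam => ?_, fun zfun hz => ?_⟩
  · exact (hfconv.add_strongConvexOn (hHstrong.const_mul hlam.le)).existsUnique_isMinOn
      (mul_pos hlam hσ) (hfcont.add (hHcont.const_mul lam)) hDne hDclosed hDconv
  obtain ⟨p, hp⟩ := hHstrong.exists_forall_le hσ hHcont
  have hlin : ∀ a b : ℝ, Tendsto (fun lam : ℝ => a + lam * b) (𝓝[>] 0) (𝓝 a) := by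
    intro a b
    have h : Continuous fun lam : ℝ => a + lam * b := by fun_prop
    simpa using (h.tendsto 0).mono_left nhdsWithin_le_nhds
  refine ⟨fun s hs => ?_, ?_⟩
  · refine tendsto_of_tendsto_of_tendsto_of_le_of_le' (hlin (f s) (H p)) (hlin (f s) (H s))
      ?_ ?_
    · filter_upwards [self_mem_nhdsWithin] with lam hlam
      exact add_le_add ((hmemS.1 hs).2 _ (hz lam hlam).1)
        (mul_le_mul_of_nonneg_left (hp _) (mem_Ioi.1 hlam).le)
    · filter_upwards [self_mem_nhdsWithin] with lam hlam
      exact (hz lam hlam).2 s (hmemS.1 hs).1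
  obtain ⟨s, hs⟩ := hSne
  have hSeq : S = D ∩ {x | f x ≤ f s} := by
    ext x
    refine ⟨fun hx => ⟨(hmemS.1 hx).1, (hmemS.1 hx).2 s (hmemS.1 hs).1⟩, fun hx => ?_⟩
    exact hmemS.2 ⟨hx.1, fun z' hz' => le_trans hx.2 ((hmemS.1 hs).2 z' hz')⟩
  have hSclosed : IsClosed S := by
    rw [hSeq]
    exact hDclosed.inter (isClosed_le hfcont continuous_const)
  have hSconv : Convex ℝ S := by
    rw [hSeq]
    exact hDconv.inter (by simpa using hfconv.convex_le (f s))
  obtain ⟨z₀, ⟨hz₀, hmin⟩, huniq⟩ :=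
    hHstrong.existsUnique_isMinOn hσ hHcont ⟨s, hs⟩ hSclosed hSconv
  refine ⟨z₀, hz₀, hmin, fun z hzS hzmin => huniq z ⟨hzS, hzmin⟩, ?_⟩
  have hz₀' := hmemS.1 hz₀
  have hHle : ∀ᶠ lam in 𝓝[>] (0 : ℝ), zfun lam ∈ {x | H x ≤ H z₀} := by
    filter_upwards [self_mem_nhdsWithin] with lam hlam
    have h₁ := (hz lam hlam).2 z₀ hz₀'.1
    have h₂ := hz₀'.2 _ (hz lam hlam).1
    exact le_of_mul_le_mul_left (by linarith) (mem_Ioi.1 hlam)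
  refine (hHstrong.isCompact_le hσ hHcont (H z₀)).tendsto_nhds_of_unique_mapClusterPt hHle
    fun z hzle hcl => ?_
  have hclosed : ∀ C : Set (EuclideanSpace ℝ (Fin N)), IsClosed C →
      (∀ᶠ lam in 𝓝[>] (0 : ℝ), zfun lam ∈ C) → z ∈ C := fun C hC hev =>
    hC.mem_of_mapClusterPt hcl hev
  have hzD : z ∈ D := hclosed D hDclosed <| by
    filter_upwards [self_mem_nhdsWithin] with lam hlam using (hz lam hlam).1
  have hfz : f z ≤ f z₀ := by
    refine le_of_forall_gt_imp_ge_of_dense fun c hc => ?_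
    refine hclosed {x | f x ≤ c} (isClosed_le hfcont continuous_const) ?_
    filter_upwards [self_mem_nhdsWithin,
      (hlin (f z₀) (H z₀ - H p)).eventually_le_const hc] with lam hlam hle
    have h₁ := (hz lam hlam).2 z₀ hz₀'.1
    have h₂ := mul_le_mul_of_nonneg_left (hp (zfun lam)) (mem_Ioi.1 hlam).le
    linarith
  exact huniq z ⟨hmemS.2 ⟨hzD, fun z' hz' => hfz.trans (hz₀'.2 z' hz')⟩,
    fun z' hz' => le_trans hzle (hmin z' hz')⟩
end

section
/- (Linear convergence of exact three-block alternating minimization for a strongly convex objective.) Let n₁, n₂, n₃ ≥ 1, let 𝒞 ⊆ ℝ^{n₃} be nonempty, closed and convex, and let f : ℝ^{n₁} × ℝ^{n₂} × ℝ^{n₃} → ℝ be continuously differentiable and σ-strongly convex for some σ > 0. Let z⁰ = (u⁰, v⁰, C⁰) with C⁰ ∈ 𝒞, and assume ∇f is Lipschitz continuous on the set {z ∈ ℝ^{n₁} × ℝ^{n₂} × 𝒞 : f(z) ≤ f(z⁰)}. Define iterates for k ≥ 1 by: u^k := the unique minimizer of u ↦ f(u, v^{k−1}, C^{k−1}) over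 ℝ^{n₁}; v^k := the unique minimizer of v ↦ f(u^k, v, C^{k−1}) over ℝ^{n₂}; C^k := the unique minimizer of C ↦ f(u^k, v^k, C) over 𝒞 (each of these minimizers exists and is unique by strong convexity). Let z* be the unique minimizer of f over ℝ^{n₁} × ℝ^{n₂} × 𝒞 and f* := f(z*). Then there exists q ∈ (0,1) such that f(z^{k+1}) − f* ≤ q·(f(z^k) − f*) for all k (Q-linear convergence of function values), and there exist M > 0 and r ∈ (0,1) such that ‖z^k − z*‖ ≤ M·r^k for all k (R-linear convergence of iterates). -/
open Filter Set Topology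

/-- The ambient Euclidean product space `ℝ^{n₁} × ℝ^{n₂} × ℝ^{n₃}` with the
Euclidean (L²) norm. -/
abbrev TripleSpace (n₁ n₂ n₃ : ℕ) : Type :=
  WithLp 2 (EuclideanSpace ℝ (Fin n₁) ×
    WithLp 2 (EuclideanSpace ℝ (Fin n₂) × EuclideanSpace ℝ (Fin n₃)))

/-- Packing three blocks into the product space. -/
noncomputable def pack {n₁ n₂ n₃ : ℕ} (u : EuclideanSpace ℝ (Fin n₁))
    (v : EuclideanSpace ℝ (Fin n₂)) (C : EuclideanSpace ℝ (Fin n₃)) :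
    TripleSpace n₁ n₂ n₃ :=
  (WithLp.equiv 2 _).symm (u, (WithLp.equiv 2 _).symm (v, C))

/-- The third block of a point of the product space. -/
noncomputable def thirdBlock {n₁ n₂ n₃ : ℕ} (z : TripleSpace n₁ n₂ n₃) :
    EuclideanSpace ℝ (Fin n₃) :=
  ((WithLp.equiv 2 _) ((WithLp.equiv 2 _) z).2).2

/-- First-order lower bound for a strongly convex differentiable function. -/
theorem StrongConvexOn.add_fderiv_add_le {E : Type*} [NormedAddCommGroup E] [NormedSpace ℝ E]
    {F : E → ℝ} {σ : ℝ} (hF : StrongConvexOn Set.univ σ F) {x : E}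
    (hd : DifferentiableAt ℝ F x) (d : E) :
    F x + fderiv ℝ F x d + σ / 2 * ‖d‖ ^ 2 ≤ F (x + d) := by
  have hlim := (hd.hasFDerivAt.hasLineDerivAt d).tendsto_slope_zero_right
  have hlim' : Tendsto (fun t : ℝ => F (x + d) - F x - (1 - t) * (σ / 2 * ‖d‖ ^ 2)) (𝓝[>] 0)
      (𝓝 (F (x + d) - F x - (1 - 0) * (σ / 2 * ‖d‖ ^ 2))) := by
    refine Tendsto.mono_left (Continuous.tendsto ?_ _) nhdsWithin_le_nhds
    fun_prop
  have hle := le_of_tendsto_of_tendsto hlim hlim' (by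
    filter_upwards [Ioo_mem_nhdsGT (zero_lt_one (α := ℝ))] with t ht
    have h := hF.2 (Set.mem_univ x) (Set.mem_univ (x + d)) (sub_nonneg.2 ht.2.le) ht.1.le
      (sub_add_cancel 1 t)
    have e : (1 - t) • x + t • (x + d) = x + t • d := by module
    have e' : x - (x + d) = -d := by abel
    rw [e, e', norm_neg] at h
    simp only [smul_eq_mul] at h ⊢
    rw [inv_mul_le_iff₀ ht.1]
    linarith)
  linarith

/-- The directional derivative is nonnegative along a segment starting at a minimizer. -/
theorem fderiv_nonneg_of_le_segment {E : Type*} [NormedAddCommGroup E] [NormedSpace ℝ E]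
    {F : E → ℝ} {x d : E} (hd : DifferentiableAt ℝ F x)
    (hmin : ∀ t : ℝ, 0 ≤ t → t ≤ 1 → F x ≤ F (x + t • d)) : 0 ≤ fderiv ℝ F x d := by
  refine ge_of_tendsto (hd.hasFDerivAt.hasLineDerivAt d).tendsto_slope_zero_right ?_
  filter_upwards [Ioo_mem_nhdsGT (zero_lt_one (α := ℝ))] with t ht
  exact smul_nonneg (inv_nonneg.2 ht.1.le) (sub_nonneg.2 (hmin t ht.1.le ht.2.le))

/-- Quadratic growth of a strongly convex function along a segment starting at a minimizer. -/
theorem StrongConvexOn.add_sq_norm_le_of_le_segment {E : Type*} [NormedAddCommGroup E]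
    [NormedSpace ℝ E] {F : E → ℝ} {σ : ℝ} (hF : StrongConvexOn Set.univ σ F) {x d : E}
    (hd : DifferentiableAt ℝ F x)
    (hmin : ∀ t : ℝ, 0 ≤ t → t ≤ 1 → F x ≤ F (x + t • d)) :
    F x + σ / 2 * ‖d‖ ^ 2 ≤ F (x + d) := by
  linarith [hF.add_fderiv_add_le hd d, fderiv_nonneg_of_le_segment hd hmin]

section Pack

variable {n₁ n₂ n₃ : ℕ}

theorem pack_add_smul (u a : EuclideanSpace ℝ (Fin n₁)) (v b : EuclideanSpace ℝ (Fin n₂))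
    (C c : EuclideanSpace ℝ (Fin n₃)) (t : ℝ) :
    pack u v C + t • pack a b c = pack (u + t • a) (v + t • b) (C + t • c) := rfl

theorem pack_add (u a : EuclideanSpace ℝ (Fin n₁)) (v b : EuclideanSpace ℝ (Fin n₂))
    (C c : EuclideanSpace ℝ (Fin n₃)) :
    pack u v C + pack a b c = pack (u + a) (v + b) (C + c) := rfl

theorem pack_sub (u a : EuclideanSpace ℝ (Fin n₁)) (v b : EuclideanSpace ℝ (Fin n₂))
    (C c : EuclideanSpace ℝ (Fin n₃)) :
    pack u v C - pack a b c = pack (u - a) (v - b) (C - c) := rfl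

theorem norm_pack_sq (u : EuclideanSpace ℝ (Fin n₁)) (v : EuclideanSpace ℝ (Fin n₂))
    (C : EuclideanSpace ℝ (Fin n₃)) :
    ‖pack u v C‖ ^ 2 = ‖u‖ ^ 2 + ‖v‖ ^ 2 + ‖C‖ ^ 2 := by
  rw [WithLp.prod_norm_sq_eq_of_L2, WithLp.prod_norm_sq_eq_of_L2, ← add_assoc]
  rfl

end Pack

/-- If the derivative of `F` is `L`-Lipschitz on `S`, then a derivative which is nonnegative in
direction `d` at one point of `S` is almost nonnegative at any other point. -/
theorem LipschitzOnWith.neg_mul_le_fderiv {E : Type*} [NormedAddCommGroup E] [NormedSpace ℝ E]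
    {F : E → ℝ} {L : NNReal} {S : Set E} (hL : LipschitzOnWith L (fun z => fderiv ℝ F z) S)
    {x y d : E} (hx : x ∈ S) (hy : y ∈ S) (hd : 0 ≤ fderiv ℝ F y d) {δ ε : ℝ}
    (hδ : ‖x - y‖ ≤ δ) (hε : ‖d‖ ≤ ε) : -(L * δ * ε) ≤ fderiv ℝ F x d := by
  have h1 : ‖fderiv ℝ F x - fderiv ℝ F y‖ ≤ L * δ :=
    (hL.norm_sub_le hx hy).trans (mul_le_mul_of_nonneg_left hδ L.2)
  have h2 := (fderiv ℝ F x - fderiv ℝ F y).le_of_opNorm_le_of_le h1 hε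
  rw [sub_apply, Real.norm_eq_abs] at h2
  linarith [(abs_le.1 h2).1]

/-- linear convergence of exact three-block alternating minimization
for a σ-strongly convex, continuously differentiable objective whose gradient is
Lipschitz on the initial sublevel set (intersected with the constraint). -/
theorem stmt17 {n₁ n₂ n₃ : ℕ} (hn₁ : 1 ≤ n₁) (hn₂ : 1 ≤ n₂) (hn₃ : 1 ≤ n₃)
    (𝒞 : Set (EuclideanSpace ℝ (Fin n₃))) (h𝒞ne : 𝒞.Nonempty)
    (h𝒞closed : IsClosed 𝒞) (h𝒞conv : Convex ℝ 𝒞)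
    (f : EuclideanSpace ℝ (Fin n₁) → EuclideanSpace ℝ (Fin n₂) →
      EuclideanSpace ℝ (Fin n₃) → ℝ)
    (F : TripleSpace n₁ n₂ n₃ → ℝ)
    (hF : ∀ u v C, F (pack u v C) = f u v C)
    (σ : ℝ) (hσ : 0 < σ)
    (hsmooth : ContDiff ℝ 1 F)
    (hstrong : StrongConvexOn Set.univ σ F)
    (u : ℕ → EuclideanSpace ℝ (Fin n₁)) (v : ℕ → EuclideanSpace ℝ (Fin n₂))
    (C : ℕ → EuclideanSpace ℝ (Fin n₃))
    (hC0 : C 0 ∈ 𝒞)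
    (hLip : ∃ L : NNReal, LipschitzOnWith L (fun z => fderiv ℝ F z)
      {z : TripleSpace n₁ n₂ n₃ | thirdBlock z ∈ 𝒞 ∧ F z ≤ f (u 0) (v 0) (C 0)})
    (hu : ∀ k, ∀ u', f (u (k+1)) (v k) (C k) ≤ f u' (v k) (C k))
    (hv : ∀ k, ∀ v', f (u (k+1)) (v (k+1)) (C k) ≤ f (u (k+1)) v' (C k))
    (hCmem : ∀ k, C (k+1) ∈ 𝒞)
    (hCmin : ∀ k, ∀ C' ∈ 𝒞, f (u (k+1)) (v (k+1)) (C (k+1)) ≤ f (u (k+1)) (v (k+1)) C')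
    (ustar : EuclideanSpace ℝ (Fin n₁)) (vstar : EuclideanSpace ℝ (Fin n₂))
    (Cstar : EuclideanSpace ℝ (Fin n₃)) (hCstar : Cstar ∈ 𝒞)
    (hstar : ∀ u' v' C', C' ∈ 𝒞 → f ustar vstar Cstar ≤ f u' v' C') :
    (∃ q ∈ Set.Ioo (0:ℝ) 1, ∀ k : ℕ,
      f (u (k+1)) (v (k+1)) (C (k+1)) - f ustar vstar Cstar
        ≤ q * (f (u k) (v k) (C k) - f ustar vstar Cstar)) ∧
    (∃ M : ℝ, 0 < M ∧ ∃ r ∈ Set.Ioo (0:ℝ) 1, ∀ k : ℕ,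
      ‖pack (u k) (v k) (C k) - pack ustar vstar Cstar‖ ≤ M * r ^ k) := by
  obtain ⟨L, hL⟩ := hLip
  have hd : ∀ z, DifferentiableAt ℝ F z := fun z => hsmooth.differentiable one_ne_zero z
  set fs := f ustar vstar Cstar with hfs
  have hC : ∀ k, C k ∈ 𝒞 := fun k => by
    cases k with
    | zero => exact hC0
    | succ k => exact hCmem k
  have hseg : ∀ {c c'}, c ∈ 𝒞 → c' ∈ 𝒞 → ∀ t : ℝ, 0 ≤ t → t ≤ 1 → c + t • (c' - c) ∈ 𝒞 :=
    fun hc hc' t h0 h1 => h𝒞conv.add_smul_sub_mem hc hc' ⟨h0, h1⟩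
  have hmono : ∀ k, f (u k) (v k) (C k) ≤ f (u 0) (v 0) (C 0) := fun k => by
    induction k with
    | zero => exact le_rfl
    | succ k ih => exact (((hCmin k _ (hC k)).trans (hv k _)).trans (hu k _)).trans ih
  have hdecrease : ∀ k, σ / 2 * ‖pack (u (k+1) - u k) (v (k+1) - v k) (C (k+1) - C k)‖ ^ 2
      ≤ f (u k) (v k) (C k) - f (u (k+1)) (v (k+1)) (C (k+1)) := fun k => by
    have h1 := hstrong.add_sq_norm_le_of_le_segment (d := pack (u k - u (k+1)) 0 0)
      (hd (pack (u (k+1)) (v k) (C k))) (fun t _ _ => by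
        rw [pack_add_smul, hF, hF]; simpa using hu k _)
    have h2 := hstrong.add_sq_norm_le_of_le_segment (d := pack 0 (v k - v (k+1)) 0)
      (hd (pack (u (k+1)) (v (k+1)) (C k))) (fun t _ _ => by
        rw [pack_add_smul, hF, hF]; simpa using hv k _)
    have h3 := hstrong.add_sq_norm_le_of_le_segment (d := pack 0 0 (C k - C (k+1)))
      (hd (pack (u (k+1)) (v (k+1)) (C (k+1)))) (fun t h0 h1 => by
        rw [pack_add_smul, hF, hF]
        simpa using hCmin k _ (hseg (hCmem k) (hC k) t h0 h1))
    rw [pack_add, norm_pack_sq, hF, hF] at h1 h2 h3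
    simp only [add_sub_cancel, add_zero, norm_zero] at h1 h2 h3
    rw [norm_pack_sq, norm_sub_rev (u _), norm_sub_rev (v _), norm_sub_rev (C _)]
    linarith
  have herror : ∀ k, f (u (k+1)) (v (k+1)) (C (k+1)) - fs
      ≤ 2 * L ^ 2 / σ * ‖pack (u (k+1) - u k) (v (k+1) - v k) (C (k+1) - C k)‖ ^ 2 := fun k => by
    set δ := ‖pack (u (k+1) - u k) (v (k+1) - v k) (C (k+1) - C k)‖ with hδ
    set d := pack (ustar - u (k+1)) (vstar - v (k+1)) (Cstar - C (k+1)) with hdd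
    have hsub : ∀ {a b c}, c ∈ 𝒞 → f a b c ≤ f (u k) (v k) (C k) →
        pack a b c ∈ {z : TripleSpace n₁ n₂ n₃ | thirdBlock z ∈ 𝒞 ∧
          F z ≤ f (u 0) (v 0) (C 0)} := fun hc h => ⟨hc, by
      rw [hF]; exact h.trans (hmono k)⟩
    have hm1 := hu k (u k)
    have hm2 := (hv k (v k)).trans hm1
    have hm3 := (hCmin k _ (hC k)).trans hm2
    have hgrad := hstrong.add_fderiv_add_le (hd (pack (u (k+1)) (v (k+1)) (C (k+1)))) d
    have hsplit : d = pack (ustar - u (k+1)) 0 0 + pack 0 (vstar - v (k+1)) 0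
        + pack 0 0 (Cstar - C (k+1)) := by
      simp [hdd, pack_add]
    have g1 : -(L * δ * ‖d‖) ≤ fderiv ℝ F (pack (u (k+1)) (v (k+1)) (C (k+1)))
        (pack (ustar - u (k+1)) 0 0) := by
      refine hL.neg_mul_le_fderiv (hsub (hCmem k) hm3) (hsub (hC k) hm1)
        (fderiv_nonneg_of_le_segment (hd _) fun t _ _ => ?_) ?_ ?_
      · rw [pack_add_smul, hF, hF]; simpa using hu k _
      all_goals
        refine le_of_sq_le_sq ?_ (norm_nonneg _)
        simp only [hδ, hdd, pack_sub, norm_pack_sq, sub_self, norm_zero]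
        nlinarith [sq_nonneg ‖u (k+1) - u k‖, sq_nonneg ‖vstar - v (k+1)‖,
          sq_nonneg ‖Cstar - C (k+1)‖]
    have g2 : -(L * δ * ‖d‖) ≤ fderiv ℝ F (pack (u (k+1)) (v (k+1)) (C (k+1)))
        (pack 0 (vstar - v (k+1)) 0) := by
      refine hL.neg_mul_le_fderiv (hsub (hCmem k) hm3) (hsub (hC k) hm2)
        (fderiv_nonneg_of_le_segment (hd _) fun t _ _ => ?_) ?_ ?_
      · rw [pack_add_smul, hF, hF]; simpa using hv k _
      all_goals
        refine le_of_sq_le_sq ?_ (norm_nonneg _)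
        simp only [hδ, hdd, pack_sub, norm_pack_sq, sub_self, norm_zero]
        nlinarith [sq_nonneg ‖u (k+1) - u k‖, sq_nonneg ‖v (k+1) - v k‖,
          sq_nonneg ‖ustar - u (k+1)‖, sq_nonneg ‖Cstar - C (k+1)‖]
    have g3 : 0 ≤ fderiv ℝ F (pack (u (k+1)) (v (k+1)) (C (k+1)))
        (pack 0 0 (Cstar - C (k+1))) := by
      refine fderiv_nonneg_of_le_segment (hd _) fun t h0 h1 => ?_
      rw [pack_add_smul, hF, hF]
      simpa using hCmin k _ (hseg (hCmem k) hCstar t h0 h1)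
    have hval : F (pack (u (k+1)) (v (k+1)) (C (k+1)) + d) = fs := by
      rw [hdd, pack_add, hF]; simp [hfs]
    have hlin : fderiv ℝ F (pack (u (k+1)) (v (k+1)) (C (k+1))) d ≥ -(2 * (L * δ * ‖d‖)) := by
      rw [hsplit, map_add, map_add, ← hsplit]
      linarith
    rw [hval, hF] at hgrad
    have hyoung : 2 * (L * δ * ‖d‖) - σ / 2 * ‖d‖ ^ 2 ≤ 2 * L ^ 2 / σ * δ ^ 2 := by
      have : 2 * L ^ 2 / σ * δ ^ 2 - (2 * (L * δ * ‖d‖) - σ / 2 * ‖d‖ ^ 2)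
          = (2 * L * δ - σ * ‖d‖) ^ 2 / (2 * σ) := by
        field_simp; ring
      have : 0 ≤ (2 * L * δ - σ * ‖d‖) ^ 2 / (2 * σ) := by positivity
      linarith
    linarith
  set c : ℝ := 4 * L ^ 2 / σ ^ 2 + 1 with hc
  have hcpos : 0 < c := by positivity
  have hq : c / (1 + c) ∈ Set.Ioo (0 : ℝ) 1 :=
    ⟨by positivity, by rw [div_lt_one (by positivity)]; linarith⟩
  have hQ : ∀ k, f (u (k+1)) (v (k+1)) (C (k+1)) - fs
      ≤ c / (1 + c) * (f (u k) (v k) (C k) - fs) := fun k => by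
    have h1 := hdecrease k
    have h2 := herror k
    set D := ‖pack (u (k+1) - u k) (v (k+1) - v k) (C (k+1) - C k)‖ ^ 2
    have hD : 0 ≤ D := by positivity
    have h3 : 2 * L ^ 2 / σ * D ≤ c * (σ / 2 * D) := by
      have : c * (σ / 2 * D) = 2 * L ^ 2 / σ * D + σ / 2 * D := by
        rw [hc]; field_simp; ring
      have : 0 ≤ σ / 2 * D := by positivity
      linarith
    have h4 := mul_le_mul_of_nonneg_left h1 hcpos.le
    rw [div_mul_eq_mul_div, le_div_iff₀ (by positivity)]
    linarith
  refine ⟨⟨_, hq, hQ⟩, ?_⟩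
  set q := c / (1 + c)
  have hgeom : ∀ k, f (u k) (v k) (C k) - fs ≤ q ^ k * (f (u 0) (v 0) (C 0) - fs) := fun k => by
    induction k with
    | zero => simp
    | succ k ih =>
      refine (hQ k).trans ?_
      rw [pow_succ', mul_assoc]
      exact mul_le_mul_of_nonneg_left ih hq.1.le
  have hgap : ∀ k, σ / 2 * ‖pack (u k) (v k) (C k) - pack ustar vstar Cstar‖ ^ 2
      ≤ f (u k) (v k) (C k) - fs := fun k => by
    have h := hstrong.add_sq_norm_le_of_le_segment
      (d := pack (u k) (v k) (C k) - pack ustar vstar Cstar)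
      (hd (pack ustar vstar Cstar)) (fun t h0 h1 => by
        rw [pack_sub, pack_add_smul, hF, hF]
        exact hstar _ _ _ (hseg hCstar (hC k) t h0 h1))
    rw [add_sub_cancel, hF, hF] at h
    linarith
  have hΔ : 0 ≤ f (u 0) (v 0) (C 0) - fs := sub_nonneg.2 (hstar _ _ _ hC0)
  refine ⟨√(2 / σ * (f (u 0) (v 0) (C 0) - fs)) + 1, by positivity, √q,
    ⟨Real.sqrt_pos.2 hq.1, by rw [Real.sqrt_lt' one_pos]; simpa using hq.2⟩, fun k => ?_⟩
  have hsq : ‖pack (u k) (v k) (C k) - pack ustar vstar Cstar‖ ^ 2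
      ≤ (√(2 / σ * (f (u 0) (v 0) (C 0) - fs)) * √q ^ k) ^ 2 := by
    rw [mul_pow, ← pow_mul, mul_comm k 2, pow_mul, Real.sq_sqrt hq.1.le,
      Real.sq_sqrt (by positivity)]
    have h := (hgap k).trans (hgeom k)
    calc _ = 2 / σ * (σ / 2 * ‖pack (u k) (v k) (C k) - pack ustar vstar Cstar‖ ^ 2) := by
          field_simp
      _ ≤ 2 / σ * (q ^ k * (f (u 0) (v 0) (C 0) - fs)) :=
          mul_le_mul_of_nonneg_left h (by positivity)
      _ = _ := by ring
  refine (le_of_sq_le_sq hsq (by positivity)).trans ?_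
  gcongr
  linarith
end

section
/- (Lower bound on step sizes rejected by the Armijo backtracking test for projected gradient steps.) Let 𝒞 ⊆ ℝ^m be nonempty, closed and convex, let f : ℝ^m → ℝ be differentiable with L-Lipschitz gradient for some L > 0, let c₁ ∈ (0,1), let x ∈ 𝒞, and let g := ∇f(x). For α > 0, set d(α) := P_𝒞(x − αg) − x, where P_𝒞 denotes the Euclidean projection onto 𝒞. If d(α) ≠ 0 and the Armijo condition fails at step size α, i.e. f(x + d(α)) > f(x) + c₁ ⟨g, d(α)⟩, then α > 2(1 − c₁)/L. -/
open Filter Set Topology RealInnerProductSpace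

/-- The descent lemma: a function with `L`-Lipschitz gradient lies below its quadratic upper
model. -/
theorem le_quadratic_of_lipschitz_gradient {E : Type*} [NormedAddCommGroup E]
    [InnerProductSpace ℝ E] [CompleteSpace E] {f : E → ℝ} {f' : E → E} {L : ℝ}
    (hf : ∀ x, HasGradientAt f (f' x) x) (hLip : ∀ x y, ‖f' x - f' y‖ ≤ L * ‖x - y‖) (x d : E) :
    f (x + d) ≤ f x + ⟪f' x, d⟫ + L / 2 * ‖d‖ ^ 2 := by
  have hline (t : ℝ) : HasDerivAt (fun t : ℝ => x + t • d) d t := by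
    simpa using ((hasDerivAt_id t).smul_const d).const_add x
  have hderiv (t : ℝ) : HasDerivAt
      (fun t : ℝ => f (x + t • d) - t * ⟪f' x, d⟫ - L / 2 * ‖d‖ ^ 2 * t ^ 2)
      (⟪f' (x + t • d), d⟫ - ⟪f' x, d⟫ - L * ‖d‖ ^ 2 * t) t := by
    have hcomp := (hf (x + t • d)).hasFDerivAt.comp_hasDerivAt t (hline t)
    rw [InnerProductSpace.toDual_apply_apply] at hcomp
    have hquad := ((hasDerivAt_id t).pow 2).const_mul (L / 2 * ‖d‖ ^ 2)
    refine ((hcomp.sub ((hasDerivAt_id t).mul_const ⟪f' x, d⟫)).sub hquad).congr_deriv ?_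
    simp only [id_eq]
    push_cast
    ring
  have hanti := antitoneOn_of_hasDerivWithinAt_nonpos (convex_Icc (0 : ℝ) 1)
    (fun t _ => (hderiv t).continuousAt.continuousWithinAt)
    (fun t _ => (hderiv t).hasDerivWithinAt) (fun t ht => by
      have ht0 : 0 ≤ t := (interior_subset ht).1
      have hinner := real_inner_le_norm (f' (x + t • d) - f' x) d
      have hnorm := mul_le_mul_of_nonneg_right (hLip (x + t • d) x) (norm_nonneg d)
      rw [add_sub_cancel_left, norm_smul, Real.norm_of_nonneg ht0] at hnorm
      rw [inner_sub_left] at hinner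
      linarith)
  have hle := hanti (left_mem_Icc.2 zero_le_one) (right_mem_Icc.2 zero_le_one) zero_le_one
  simp only [one_smul, zero_smul, add_zero] at hle
  linarith

/-- any step size rejected by the Armijo backtracking test for a
projected gradient step exceeds `2(1 - c₁)/L`.  The Euclidean projection `P` onto
the nonempty closed convex set `𝒞` is characterized by its variational
inequality. -/
theorem stmt18 {m : ℕ} (hm : 1 ≤ m)
    (𝒞 : Set (EuclideanSpace ℝ (Fin m))) (h𝒞ne : 𝒞.Nonempty)
    (h𝒞closed : IsClosed 𝒞) (h𝒞conv : Convex ℝ 𝒞)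
    (P : EuclideanSpace ℝ (Fin m) → EuclideanSpace ℝ (Fin m))
    (hPmem : ∀ y, P y ∈ 𝒞)
    (hPproj : ∀ y, ∀ z ∈ 𝒞, ⟪y - P y, z - P y⟫ ≤ (0:ℝ))
    (f : EuclideanSpace ℝ (Fin m) → ℝ)
    (f' : EuclideanSpace ℝ (Fin m) → EuclideanSpace ℝ (Fin m))
    (hf : ∀ x, HasGradientAt f (f' x) x)
    (L : ℝ) (hL : 0 < L)
    (hLip : ∀ x y, ‖f' x - f' y‖ ≤ L * ‖x - y‖)
    (c₁ : ℝ) (hc₁ : c₁ ∈ Set.Ioo (0:ℝ) 1)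
    (x : EuclideanSpace ℝ (Fin m)) (hx : x ∈ 𝒞)
    (α : ℝ) (hα : 0 < α)
    (d : EuclideanSpace ℝ (Fin m)) (hd : d = P (x - α • f' x) - x)
    (hdne : d ≠ 0)
    (hArmijoFail : f x + c₁ * ⟪f' x, d⟫ < f (x + d)) :
    2 * (1 - c₁) / L < α := by
  have hdescent := le_quadratic_of_lipschitz_gradient hf hLip x d
  have hP : P (x - α • f' x) = x + d := by rw [hd]; abel
  have hproj := hPproj (x - α • f' x) x hx
  rw [hP, show x - α • f' x - (x + d) = -(α • f' x + d) by abel,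
    show x - (x + d) = -d by abel, inner_neg_neg, inner_add_left, real_inner_smul_left,
    real_inner_self_eq_norm_sq] at hproj
  have hdpos : 0 < ‖d‖ ^ 2 := by positivity
  have hreject : (1 - c₁) * -⟪f' x, d⟫ < L / 2 * ‖d‖ ^ 2 := by linarith
  have hscaled := mul_lt_mul_of_pos_left hreject hα
  have hlower := mul_le_mul_of_nonneg_left hproj (sub_nonneg.2 hc₁.2.le)
  rw [div_lt_iff₀ hL]
  refine lt_of_mul_lt_mul_right ?_ hdpos.le
  linarith
end
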